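/- arXiv:1903.11914 — 12 statements merged into one kernel-verified Lean document; each statement's English description precedes it below -/
import Mathlib

section
/- Let c > 0 and let Γ be a compact transition mask with half-width c. If u : ℝ → ℝ is twice continuously differentiable, satisfies u''(ξ) = Γ(ξ)·u(ξ) for all ξ ∈ ℝ, and u is bounded on ℝ, then u is identically zero. (This is the leading-order boundary-layer statement: the only bounded solution of the inner problem is the zero solution, which enforces the no-slip condition.) -/
open Real Filter Set

/-- A compact transition mask with half-width `c`: continuous, valued in `[0,1]`,
identically `1` on `(-∞, -c]` (the solid) and `0` on `[c, ∞)` (the fluid). -/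
structure CompactMask (c : ℝ) (Γ : ℝ → ℝ) : Prop where
  cont : Continuous Γ
  nonneg : ∀ ξ, 0 ≤ Γ ξ
  le_one : ∀ ξ, Γ ξ ≤ 1
  eq_one : ∀ ξ, ξ ≤ -c → Γ ξ = 1
  eq_zero : ∀ ξ, c ≤ ξ → Γ ξ = 0

/-- the only bounded solution of the inner problem `u'' = Γ u` is zero. -/
theorem bounded_inner_solution_eq_zero {c : ℝ} (hc : 0 < c) {Γ : ℝ → ℝ}
    (hΓ : CompactMask c Γ) {u : ℝ → ℝ} (hu : ContDiff ℝ 2 u)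
    (hode : ∀ ξ : ℝ, deriv (deriv u) ξ = Γ ξ * u ξ)
    (hbdd : ∃ M : ℝ, ∀ ξ : ℝ, |u ξ| ≤ M) :
    ∀ ξ : ℝ, u ξ = 0 := by
  obtain ⟨M, hM⟩ := hbdd
  have hdu : ∀ x, HasDerivAt u (deriv u x) x := fun x =>
    (hu.differentiable (by norm_num) x).hasDerivAt
  have hu' : ContDiff ℝ 1 (deriv u) := by
    have h2 : ContDiff ℝ (1 + 1) u := by
      convert hu using 1
      norm_num
    exact (contDiff_succ_iff_deriv.1 h2).2.2
  have hddu : ∀ x, HasDerivAt (deriv u) (Γ x * u x) x := fun x => by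
    rw [← hode x]
    exact (hu'.differentiable (by norm_num) x).hasDerivAt
  have hw : ∀ x, HasDerivAt (fun y => u y * u y) (2 * (u x * deriv u x)) x := fun x => by
    have e : 2 * (u x * deriv u x) = deriv u x * u x + u x * deriv u x := by ring
    rw [e]
    exact (hdu x).mul (hdu x)
  have hp : ∀ x, HasDerivAt (fun y => 2 * (u y * deriv u y))
      (2 * (deriv u x * deriv u x + u x * (Γ x * u x))) x := fun x =>
    ((hdu x).mul (hddu x)).const_mul 2
  have hmono : Monotone (fun y => 2 * (u y * deriv u y)) := by
    refine monotone_of_deriv_nonneg (fun x => (hp x).differentiableAt) fun x => ?_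
    rw [(hp x).deriv]
    nlinarith [mul_self_nonneg (deriv u x), mul_nonneg (hΓ.nonneg x) (mul_self_nonneg (u x))]
  have hub : ∀ x, u x * u x ≤ M * M := fun x => by
    rw [← abs_mul_abs_self (u x)]
    exact mul_self_le_mul_self (abs_nonneg _) (hM x)
  have hcont : Continuous (fun y => u y * u y) := hu.continuous.mul hu.continuous
  -- tangent line inequality
  have htan : ∀ a b, u a * u a + 2 * (u a * deriv u a) * (b - a) ≤ u b * u b := by
    intro a b
    rcases lt_trichotomy a b with h | h | h
    · obtain ⟨z, hz, he⟩ := exists_hasDerivAt_eq_slope _ _ h hcont.continuousOn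
        (fun x _ => hw x)
      have h1 := hmono hz.1.le
      have h0 : 0 < b - a := sub_pos.2 h
      rw [eq_div_iff h0.ne'] at he
      simp only at h1
      nlinarith [mul_le_mul_of_nonneg_right h1 h0.le]
    · subst h
      simp
    · obtain ⟨z, hz, he⟩ := exists_hasDerivAt_eq_slope _ _ h hcont.continuousOn
        (fun x _ => hw x)
      have h1 := hmono hz.2.le
      have h0 : 0 < a - b := sub_pos.2 h
      rw [eq_div_iff h0.ne'] at he
      simp only at h1
      nlinarith [mul_le_mul_of_nonneg_right h1 h0.le]
  have hp0 : ∀ a, 2 * (u a * deriv u a) = 0 := by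
    intro a
    by_contra hk
    have h1 := htan a (a + (M * M + 1) / (2 * (u a * deriv u a)))
    rw [add_sub_cancel_left, mul_div_cancel₀ _ hk] at h1
    linarith [hub (a + (M * M + 1) / (2 * (u a * deriv u a))), mul_self_nonneg (u a)]
  have hc0 : u (-c) = 0 := by
    have h1 := hp (-c)
    have h2 : (fun y => 2 * (u y * deriv u y)) = fun _ => (0 : ℝ) := funext hp0
    rw [h2] at h1
    have h3 := h1.unique (hasDerivAt_const (-c) (0 : ℝ))
    rw [hΓ.eq_one (-c) le_rfl] at h3
    have h4 : u (-c) * u (-c) = 0 := by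
      nlinarith [mul_self_nonneg (deriv u (-c)), mul_self_nonneg (u (-c))]
    exact mul_self_eq_zero.1 h4
  intro ξ
  have h1 := htan ξ (-c)
  rw [hp0 ξ, hc0] at h1
  exact mul_self_eq_zero.1 (le_antisymm (by linarith) (mul_self_nonneg _))
end

section
/- Let c > 0 and let Γ be a compact transition mask with half-width c. If u₁, u₂ : ℝ → ℝ are twice continuously differentiable solutions of u''(ξ) = Γ(ξ)·u(ξ) on ℝ that both tend to 0 as ξ → −∞, then u₁ and u₂ are linearly dependent; i.e., the decaying solution of the inner problem is unique up to a scalar multiple. -/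
open Real Filter Set

/-- A decaying solution vanishing at `x` vanishes everywhere to the left of `x`: its square is
convex and tends to zero at `-∞`. -/
lemma decaying_zero_left {Γ w v : ℝ → ℝ} (hΓ : ∀ ξ, 0 ≤ Γ ξ)
    (hw : ∀ ξ, HasDerivAt w (v ξ) ξ) (hv : ∀ ξ, HasDerivAt v (Γ ξ * w ξ) ξ)
    (hd : Tendsto w atBot (nhds 0)) {x y : ℝ} (hx : w x = 0) (hyx : y ≤ x) : w y = 0 := by
  have hg : ∀ ξ, HasDerivAt (fun t => w t ^ 2) (2 * (w ξ * v ξ)) ξ := fun ξ => by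
    refine ((hw ξ).fun_pow 2).congr_deriv ?_
    push_cast
    ring
  have hg' : ∀ ξ, HasDerivAt (fun t => 2 * (w t * v t))
      (2 * (v ξ * v ξ + w ξ * (Γ ξ * w ξ))) ξ := fun ξ =>
    ((hw ξ).fun_mul (hv ξ)).const_mul 2
  have hmono : Monotone (fun t => 2 * (w t * v t)) := by
    refine monotone_of_deriv_nonneg (fun ξ => (hg' ξ).differentiableAt) (fun ξ => ?_)
    rw [(hg' ξ).deriv]
    nlinarith [mul_self_nonneg (v ξ), mul_nonneg (hΓ ξ) (mul_self_nonneg (w ξ))]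
  have hconv : ConvexOn ℝ univ (fun t => w t ^ 2) := by
    refine Monotone.convexOn_univ_of_deriv (fun ξ => (hg ξ).differentiableAt) ?_
    have : deriv (fun t => w t ^ 2) = fun t => 2 * (w t * v t) := funext fun ξ => (hg ξ).deriv
    rw [this]
    exact hmono
  by_contra hy
  have hpos : 0 < w y ^ 2 := by positivity
  have hle : ∀ z, z ≤ y → w y ^ 2 ≤ w z ^ 2 := fun z hz => by
    have h := hconv.le_max_of_mem_Icc (mem_univ z) (mem_univ x) (z := y) ⟨hz, hyx⟩
    rcases le_max_iff.1 h with h | h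
    · exact h
    · simp only [hx] at h
      linarith
  have hlim : Tendsto (fun t => w t ^ 2) atBot (nhds 0) := by
    simpa using hd.pow 2
  have := ge_of_tendsto hlim ((eventually_le_atBot y).mono hle)
  linarith

/-- any two solutions of the inner problem `u'' = Γ u` decaying as `ξ → -∞`
are linearly dependent: the decaying (physical) solution is unique up to scalar multiple. -/
theorem decaying_inner_solutions_linearly_dependent {c : ℝ} (hc : 0 < c) {Γ : ℝ → ℝ}
    (hΓ : CompactMask c Γ) {u₁ u₂ : ℝ → ℝ}
    (hu₁ : ContDiff ℝ 2 u₁) (hu₂ : ContDiff ℝ 2 u₂)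
    (hode₁ : ∀ ξ : ℝ, deriv (deriv u₁) ξ = Γ ξ * u₁ ξ)
    (hode₂ : ∀ ξ : ℝ, deriv (deriv u₂) ξ = Γ ξ * u₂ ξ)
    (hdecay₁ : Tendsto u₁ atBot (nhds 0)) (hdecay₂ : Tendsto u₂ atBot (nhds 0)) :
    ∃ a b : ℝ, (a ≠ 0 ∨ b ≠ 0) ∧ ∀ ξ : ℝ, a * u₁ ξ + b * u₂ ξ = 0 := by
  have key : ∀ u : ℝ → ℝ, ContDiff ℝ 2 u → (∀ ξ : ℝ, deriv (deriv u) ξ = Γ ξ * u ξ) →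
      (∀ ξ, HasDerivAt u (deriv u ξ) ξ) ∧ ∀ ξ, HasDerivAt (deriv u) (Γ ξ * u ξ) ξ := by
    intro u hu ho
    have h1 : ContDiff ℝ 1 (deriv u) := hu.deriv' (n := 1)
    refine ⟨fun ξ => (hu.differentiable (by norm_num) ξ).hasDerivAt, fun ξ => ?_⟩
    rw [← ho]
    exact (h1.differentiable (by norm_num) ξ).hasDerivAt
  obtain ⟨a1, a2⟩ := key u₁ hu₁ hode₁
  obtain ⟨b1, b2⟩ := key u₂ hu₂ hode₂
  have main : ∀ x y, y ≤ x → u₂ x * u₁ y + (-u₁ x) * u₂ y = 0 := by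
    intro x y hyx
    refine decaying_zero_left (Γ := Γ) (w := fun t => u₂ x * u₁ t + (-u₁ x) * u₂ t)
      (v := fun t => u₂ x * deriv u₁ t + (-u₁ x) * deriv u₂ t) hΓ.nonneg
      (fun ξ => ((a1 ξ).const_mul _).fun_add ((b1 ξ).const_mul _))
      (fun ξ => (((a2 ξ).const_mul _).fun_add ((b2 ξ).const_mul _)).congr_deriv (by ring))
      ?_ (x := x) (by ring) hyx
    simpa using (hdecay₁.const_mul (u₂ x)).add (hdecay₂.const_mul (-u₁ x))
  by_cases h : ∀ x, u₁ x = 0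
  · exact ⟨1, 0, Or.inl one_ne_zero, fun ξ => by simp [h ξ]⟩
  · push Not at h
    obtain ⟨p, hp⟩ := h
    refine ⟨u₂ p, -u₁ p, Or.inr (neg_ne_zero.2 hp), fun ξ => ?_⟩
    rcases le_total ξ p with h | h
    · exact main p ξ h
    · linarith [main ξ p h]
end

section
/- Let c > 0 and let Γ be a compact transition mask with half-width c. Then there exists a unique twice continuously differentiable solution U : ℝ → ℝ of U''(ξ) = Γ(ξ)·U(ξ) with U(ξ) = e^ξ for all ξ ≤ −c. This U is positive and strictly increasing on all of ℝ, and there exist constants A ≥ e^{−c} and ℓ* ∈ ℝ such that U(ξ) = A(ξ − ℓ*) for all ξ ≥ c. In particular, every compact mask possesses a well-defined displacement length ℓ*. -/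
open Real Filter Set

/-- Clamping to `[-M, M]`. -/
def maskClamp (M x : ℝ) : ℝ := max (-M) (min M x)

lemma maskClamp_lip (M x y : ℝ) : |maskClamp M x - maskClamp M y| ≤ |x - y| := by
  unfold maskClamp
  refine (abs_max_sub_max_le_max _ _ _ _).trans (max_le (by simp) ?_)
  exact (abs_min_sub_min_le_max _ _ _ _).trans (max_le (by simp) le_rfl)

lemma maskClamp_bound {M : ℝ} (hM : 0 ≤ M) (x : ℝ) : |maskClamp M x| ≤ M := by
  unfold maskClamp
  rw [abs_le]
  exact ⟨le_max_left _ _, max_le (by linarith) (min_le_left _ _)⟩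

lemma maskClamp_le {M : ℝ} (hM : 0 ≤ M) (x : ℝ) : |maskClamp M x| ≤ |x| := by
  have h := maskClamp_lip M x 0
  have h0 : maskClamp M 0 = 0 := by
    unfold maskClamp
    rw [min_eq_right hM, max_eq_right (by linarith)]
  simpa [h0] using h

lemma maskClamp_eq {M x : ℝ} (h : |x| ≤ M) : maskClamp M x = x := by
  rw [abs_le] at h
  unfold maskClamp
  rw [min_eq_right h.2, max_eq_right h.1]

/-- Two functions on `[a, b]` with the same derivative and initial value agree. -/
lemma mask_eq_of_deriv {a b : ℝ} {f g f' : ℝ → ℝ}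
    (hf : ∀ t ∈ Icc a b, HasDerivWithinAt f (f' t) (Icc a b) t)
    (hg : ∀ t ∈ Icc a b, HasDerivWithinAt g (f' t) (Icc a b) t) (t₀ : ℝ) (ht₀ : t₀ ∈ Icc a b)
    (h0 : f t₀ = g t₀) : ∀ t ∈ Icc a b, f t = g t := by
  have key : ∀ t ∈ Icc a b, f t - g t = f a - g a := by
    apply constant_of_has_deriv_right_zero (f := fun t => f t - g t)
    · exact fun t ht => ((hf t ht).sub (hg t ht)).continuousWithinAt
    · intro t ht
      have h := (hf t (Ico_subset_Icc_self ht)).sub (hg t (Ico_subset_Icc_self ht))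
      rw [sub_self] at h
      exact h.mono_of_mem_nhdsWithin (Icc_mem_nhdsGE_of_mem ht)
  intro t ht
  have h1 := key t ht
  have h2 := key t₀ ht₀
  linarith

/-- Existence on a compact interval. -/
lemma mask_local_exists {Γ : ℝ → ℝ} (hcont : Continuous Γ) (h0 : ∀ t, 0 ≤ Γ t)
    (h1 : ∀ t, Γ t ≤ 1) {a b : ℝ} (hab : a ≤ b) (p q : ℝ) :
    ∃ u v : ℝ → ℝ, u a = p ∧ v a = q ∧
      (∀ t ∈ Icc a b, HasDerivWithinAt u (v t) (Icc a b) t) ∧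
      (∀ t ∈ Icc a b, HasDerivWithinAt v (Γ t * u t) (Icc a b) t) := by
  set M : ℝ := ‖((p, q) : ℝ × ℝ)‖ * Real.exp (b - a) with hM
  have hM0 : 0 ≤ M := by positivity
  let f : ℝ → ℝ × ℝ → ℝ × ℝ := fun t x => (maskClamp M x.2, Γ t * maskClamp M x.1)
  have hmul : ∀ t y, |Γ t * y| ≤ |y| := by
    intro t y
    rw [abs_mul, abs_of_nonneg (h0 t)]
    exact mul_le_of_le_one_left (abs_nonneg _) (h1 t)
  have hPL : IsPicardLindelof f (⟨a, left_mem_Icc.2 hab⟩ : Icc a b) ((p, q) : ℝ × ℝ)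
      (⟨M * (b - a), mul_nonneg hM0 (by linarith)⟩) 0 ⟨M, hM0⟩ 1 := by
    constructor
    · intro t _
      apply LipschitzWith.lipschitzOnWith
      apply LipschitzWith.of_dist_le_mul
      intro x y
      simp only [NNReal.coe_one, one_mul]
      rw [dist_eq_norm, dist_eq_norm, Prod.norm_def, Prod.norm_def]
      simp only [f, Prod.fst_sub, Prod.snd_sub, Real.norm_eq_abs]
      rw [← mul_sub]
      apply max_le
      · exact (maskClamp_lip M _ _).trans (le_max_right _ _)
      · exact ((hmul t _).trans (maskClamp_lip M _ _)).trans (le_max_left _ _)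
    · intro x _
      apply Continuous.continuousOn
      simp only [f]
      fun_prop
    · intro t _ x _
      rw [Prod.norm_def]
      simp only [f, Real.norm_eq_abs]
      exact max_le (maskClamp_bound hM0 _) ((hmul t _).trans (maskClamp_bound hM0 _))
    · simp only [NNReal.coe_zero, sub_zero, sub_self]
      rw [max_eq_left (by linarith)]
      exact le_rfl
  obtain ⟨α, hα0, hα⟩ := hPL.exists_eq_forall_mem_Icc_hasDerivWithinAt₀
  simp only at hα0
  have hbound : ∀ t ∈ Icc a b, ‖α t‖ ≤ M := by
    intro t ht
    have h := norm_le_gronwallBound_of_norm_deriv_right_le (f := α) (f' := fun t => f t (α t))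
      (δ := ‖((p, q) : ℝ × ℝ)‖) (K := 1) (ε := 0) (a := a) (b := b)
      (fun t ht => (hα t ht).continuousWithinAt)
      (fun t ht => (hα t (Ico_subset_Icc_self ht)).mono_of_mem_nhdsWithin
        (Icc_mem_nhdsGE_of_mem ht)) (by rw [hα0]) (by
          intro t _
          rw [one_mul, add_zero, Prod.norm_def, Prod.norm_def]
          simp only [f, Real.norm_eq_abs]
          apply max_le
          · exact (maskClamp_le hM0 _).trans (le_max_right _ _)
          · exact ((hmul t _).trans (maskClamp_le hM0 _)).trans (le_max_left _ _)) t ht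
    rw [gronwallBound_ε0] at h
    refine h.trans ?_
    rw [hM]
    gcongr
    linarith [ht.2]
  refine ⟨fun t => (α t).1, fun t => (α t).2, by simp [hα0], by simp [hα0], ?_, ?_⟩
  · intro t ht
    have h := hasFDerivAt_fst.comp_hasDerivWithinAt (𝕜 := ℝ) t (hα t ht)
    have hb : |(α t).2| ≤ M := (norm_snd_le (α t)).trans (hbound t ht)
    refine h.congr_deriv ?_
    simp only [ContinuousLinearMap.coe_fst', f, maskClamp_eq hb]
  · intro t ht
    have h := hasFDerivAt_snd.comp_hasDerivWithinAt (𝕜 := ℝ) t (hα t ht)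
    have hb : |(α t).1| ≤ M := (norm_fst_le (α t)).trans (hbound t ht)
    refine h.congr_deriv ?_
    simp only [ContinuousLinearMap.coe_snd', f, maskClamp_eq hb]

/-- Global existence. -/
lemma mask_exists {c : ℝ} (hc : 0 < c) {Γ : ℝ → ℝ} (hΓ : CompactMask c Γ) :
    ∃ U : ℝ → ℝ, ContDiff ℝ 2 U ∧ (∀ ξ : ℝ, deriv (deriv U) ξ = Γ ξ * U ξ) ∧
      (∀ ξ : ℝ, ξ ≤ -c → U ξ = Real.exp ξ) := by
  have hcc : -c ≤ c := by linarith
  obtain ⟨u, v, hu0, hv0, hu, hv⟩ := mask_local_exists hΓ.cont hΓ.nonneg hΓ.le_one hcc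
    (Real.exp (-c)) (Real.exp (-c))
  have huc : ContinuousOn u (Icc (-c) c) := fun t ht => (hu t ht).continuousWithinAt
  let w : ℝ → ℝ := IccExtend hcc ((Icc (-c) c).domRestrict u)
  have hwc : Continuous w := (continuousOn_iff_continuous_domRestrict.1 huc).Icc_extend'
  let g : ℝ → ℝ := fun t => Γ t * (Real.exp (min t (-c)) + w t - Real.exp (-c))
  have hgc : Continuous g := by
    have := hΓ.cont
    simp only [g]
    fun_prop
  let V : ℝ → ℝ := fun x => Real.exp (-c) + ∫ t in (-c)..x, g t
  have hV : ∀ x, HasDerivAt V (g x) x := fun x =>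
    (intervalIntegral.integral_hasDerivAt_right (hgc.intervalIntegrable _ _)
      (hgc.stronglyMeasurableAtFilter _ _) hgc.continuousAt).const_add _
  have hVc : Continuous V := continuous_iff_continuousAt.2 fun x => (hV x).continuousAt
  let U : ℝ → ℝ := fun x => Real.exp (-c) + ∫ t in (-c)..x, V t
  have hU : ∀ x, HasDerivAt U (V x) x := fun x =>
    (intervalIntegral.integral_hasDerivAt_right (hVc.intervalIntegrable _ _)
      (hVc.stronglyMeasurableAtFilter _ _) hVc.continuousAt).const_add _
  have hV0 : V (-c) = Real.exp (-c) := by simp [V]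
  have hU0 : U (-c) = Real.exp (-c) := by simp [U]
  have hdU : deriv U = V := funext fun x => (hU x).deriv
  have hdV : deriv V = g := funext fun x => (hV x).deriv
  have hw1 : ∀ t, t ≤ -c → w t = Real.exp (-c) := by
    intro t ht
    simp only [w]
    rw [IccExtend_of_le_left hcc _ ht]
    exact hu0
  have hw2 : ∀ t ∈ Icc (-c) c, w t = u t := by
    intro t ht
    simp only [w]
    rw [IccExtend_of_mem hcc _ ht]
    rfl
  have hg1 : ∀ t, t ≤ -c → g t = Real.exp t := by
    intro t ht
    simp only [g]
    rw [hΓ.eq_one t ht, hw1 t ht, min_eq_left ht]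
    ring
  have hg2 : ∀ t ∈ Icc (-c) c, g t = Γ t * u t := by
    intro t ht
    simp only [g]
    rw [hw2 t ht, min_eq_right ht.1]
    ring
  have hVe : ∀ t, t ≤ -c → V t = Real.exp t := by
    intro t ht
    refine mask_eq_of_deriv (a := t) (b := -c) (f' := g) (fun s _ => (hV s).hasDerivWithinAt)
      (fun s hs => ?_) (-c) (right_mem_Icc.2 ht) hV0 t (left_mem_Icc.2 ht)
    rw [hg1 s hs.2]
    exact (Real.hasDerivAt_exp s).hasDerivWithinAt
  have hUe : ∀ t, t ≤ -c → U t = Real.exp t := by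
    intro t ht
    refine mask_eq_of_deriv (a := t) (b := -c) (f' := V) (fun s _ => (hU s).hasDerivWithinAt)
      (fun s hs => ?_) (-c) (right_mem_Icc.2 ht) hU0 t (left_mem_Icc.2 ht)
    rw [hVe s hs.2]
    exact (Real.hasDerivAt_exp s).hasDerivWithinAt
  have hVv : ∀ t ∈ Icc (-c) c, V t = v t := by
    refine mask_eq_of_deriv (f' := g) (fun s _ => (hV s).hasDerivWithinAt)
      (fun s hs => ?_) (-c) (left_mem_Icc.2 hcc) (by rw [hV0, hv0])
    rw [hg2 s hs]
    exact hv s hs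
  have hUu : ∀ t ∈ Icc (-c) c, U t = u t := by
    refine mask_eq_of_deriv (f' := V) (fun s _ => (hU s).hasDerivWithinAt)
      (fun s hs => ?_) (-c) (left_mem_Icc.2 hcc) (by rw [hU0, hu0])
    rw [hVv s hs]
    exact hu s hs
  refine ⟨U, ?_, ?_, hUe⟩
  · have hV1 : ContDiff ℝ 1 V := by
      rw [contDiff_one_iff_deriv]
      exact ⟨fun x => (hV x).differentiableAt, by rw [hdV]; exact hgc⟩
    rw [show (2 : WithTop ℕ∞) = 1 + 1 by norm_num, contDiff_succ_iff_deriv]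
    exact ⟨fun x => (hU x).differentiableAt, by simp, by rw [hdU]; exact hV1⟩
  · intro x
    rw [hdU, hdV]
    rcases le_total x (-c) with h | h
    · rw [hg1 x h, hUe x h, hΓ.eq_one x h, one_mul]
    · rcases le_total x c with h' | h'
      · rw [hg2 x ⟨h, h'⟩, hUu x ⟨h, h'⟩]
      · simp only [g]
        rw [hΓ.eq_zero x h', zero_mul, zero_mul]

/-- Derivative facts for a `C²` solution. -/
lemma mask_hasDeriv {U : ℝ → ℝ} (hU : ContDiff ℝ 2 U) :
    (∀ x, HasDerivAt U (deriv U x) x) ∧ (∀ x, HasDerivAt (deriv U) (deriv (deriv U) x) x) := by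
  rw [show (2 : WithTop ℕ∞) = 1 + 1 by norm_num, contDiff_succ_iff_deriv] at hU
  exact ⟨fun x => (hU.1 x).hasDerivAt,
    fun x => ((hU.2.2.differentiable (by norm_num)) x).hasDerivAt⟩

/-- On the solid side the derivative is the exponential. -/
lemma mask_deriv_exp {c : ℝ} {U : ℝ → ℝ} (hU : ∀ x, HasDerivAt U (deriv U x) x)
    (he : ∀ ξ : ℝ, ξ ≤ -c → U ξ = Real.exp ξ) : ∀ ξ, ξ ≤ -c → deriv U ξ = Real.exp ξ := by
  intro ξ hξ
  have h1 : HasDerivWithinAt U (deriv U ξ) (Iic ξ) ξ := (hU ξ).hasDerivWithinAt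
  have h2 : HasDerivWithinAt U (Real.exp ξ) (Iic ξ) ξ :=
    (Real.hasDerivAt_exp ξ).hasDerivWithinAt.congr (fun y hy => he y (le_trans hy hξ)) (he ξ hξ)
  exact (uniqueDiffWithinAt_Iic ξ).eq_deriv _ h1 h2

lemma mask_unique {c : ℝ} {Γ : ℝ → ℝ} (hΓ : CompactMask c Γ) {U₁ U₂ : ℝ → ℝ}
    (h1 : ContDiff ℝ 2 U₁) (d1 : ∀ ξ : ℝ, deriv (deriv U₁) ξ = Γ ξ * U₁ ξ)
    (e1 : ∀ ξ : ℝ, ξ ≤ -c → U₁ ξ = Real.exp ξ)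
    (h2 : ContDiff ℝ 2 U₂) (d2 : ∀ ξ : ℝ, deriv (deriv U₂) ξ = Γ ξ * U₂ ξ)
    (e2 : ∀ ξ : ℝ, ξ ≤ -c → U₂ ξ = Real.exp ξ) : U₁ = U₂ := by
  obtain ⟨a1, b1⟩ := mask_hasDeriv h1
  obtain ⟨a2, b2⟩ := mask_hasDeriv h2
  have f1 := mask_deriv_exp a1 e1
  have f2 := mask_deriv_exp a2 e2
  let E : ℝ → ℝ := fun x =>
    ((U₁ x - U₂ x) ^ 2 + (deriv U₁ x - deriv U₂ x) ^ 2) * Real.exp (-2 * x)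
  have hE : ∀ x, HasDerivAt E
      ((2 * (U₁ x - U₂ x) * (deriv U₁ x - deriv U₂ x) * (1 + Γ x)
        - 2 * ((U₁ x - U₂ x) ^ 2 + (deriv U₁ x - deriv U₂ x) ^ 2)) * Real.exp (-2 * x)) x := by
    intro x
    have hx : HasDerivAt (fun x : ℝ => Real.exp (-2 * x)) (Real.exp (-2 * x) * (-2 * 1)) x :=
      ((hasDerivAt_id x).const_mul (-2)).exp
    have h := ((((a1 x).sub (a2 x)).pow 2).add (((b1 x).sub (b2 x)).pow 2)).mul hx
    refine h.congr_deriv ?_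
    simp only [Pi.sub_apply, Pi.pow_apply, Pi.add_apply, d1 x, d2 x]
    push_cast
    ring
  have hanti : Antitone E := by
    apply antitone_of_deriv_nonpos (fun x => (hE x).differentiableAt)
    intro x
    rw [(hE x).deriv]
    apply mul_nonpos_of_nonpos_of_nonneg _ (Real.exp_pos _).le
    have g0 := hΓ.nonneg x
    have g1 := hΓ.le_one x
    nlinarith [mul_nonneg g0 (sq_nonneg ((U₁ x - U₂ x) - (deriv U₁ x - deriv U₂ x))),
      sq_nonneg ((U₁ x - U₂ x) - (deriv U₁ x - deriv U₂ x)),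
      mul_nonneg (sub_nonneg.2 g1) (sq_nonneg (U₁ x - U₂ x)),
      mul_nonneg (sub_nonneg.2 g1) (sq_nonneg (deriv U₁ x - deriv U₂ x))]
  funext x
  rcases le_total x (-c) with h | h
  · rw [e1 x h, e2 x h]
  · have h0 : E x ≤ 0 := by
      refine (hanti h).trans ?_
      simp [E, e1 (-c) le_rfl, e2 (-c) le_rfl, f1 (-c) le_rfl, f2 (-c) le_rfl]
    have h3 : (U₁ x - U₂ x) ^ 2 + (deriv U₁ x - deriv U₂ x) ^ 2 ≤ 0 :=
      nonpos_of_mul_nonpos_left h0 (Real.exp_pos _)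
    have h4 : (U₁ x - U₂ x) ^ 2 = 0 := by
      nlinarith [sq_nonneg (U₁ x - U₂ x), sq_nonneg (deriv U₁ x - deriv U₂ x)]
    exact sub_eq_zero.1 (pow_eq_zero_iff (two_ne_zero) |>.1 h4)

lemma mask_props {c : ℝ} (hc : 0 < c) {Γ : ℝ → ℝ} (hΓ : CompactMask c Γ) {U : ℝ → ℝ}
    (hU : ContDiff ℝ 2 U) (d : ∀ ξ : ℝ, deriv (deriv U) ξ = Γ ξ * U ξ)
    (e : ∀ ξ : ℝ, ξ ≤ -c → U ξ = Real.exp ξ) :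
    (∀ ξ : ℝ, 0 < U ξ) ∧ StrictMono U ∧
      ∃ A ℓstar : ℝ, Real.exp (-c) ≤ A ∧ ∀ ξ : ℝ, c ≤ ξ → U ξ = A * (ξ - ℓstar) := by
  obtain ⟨a, b⟩ := mask_hasDeriv hU
  have f := mask_deriv_exp a e
  have hP : ∀ x, HasDerivAt (fun x => U x * deriv U x) (deriv U x ^ 2 + Γ x * U x ^ 2) x := by
    intro x
    refine ((a x).mul (b x)).congr_deriv ?_
    rw [d x]
    ring
  have hmono : Monotone (fun x => U x * deriv U x) := by
    apply monotone_of_deriv_nonneg (fun x => (hP x).differentiableAt)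
    intro x
    rw [(hP x).deriv]
    have := hΓ.nonneg x
    positivity
  have hPpos : ∀ x, 0 < U x * deriv U x := by
    intro x
    have h1 : U (min x (-c)) * deriv U (min x (-c)) ≤ U x * deriv U x := hmono (min_le_left _ _)
    rw [e _ (min_le_right _ _), f _ (min_le_right _ _)] at h1
    exact lt_of_lt_of_le (by positivity) h1
  have hne : ∀ x, U x ≠ 0 := fun x hx => by
    have := hPpos x
    rw [hx, zero_mul] at this
    exact lt_irrefl _ this
  have hpos : ∀ x, 0 < U x := by
    intro x
    by_contra hx
    have hx' : U x ≤ 0 := not_lt.1 hx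
    have hc0 : 0 ≤ U (-c) := by rw [e _ le_rfl]; positivity
    obtain ⟨z, hz⟩ := mem_range_of_exists_le_of_exists_ge hU.continuous ⟨x, hx'⟩ ⟨-c, hc0⟩
    exact hne z hz
  have hdpos : ∀ x, 0 < deriv U x := fun x => (pos_iff_pos_of_mul_pos (hPpos x)).1 (hpos x)
  have hVm : Monotone (deriv U) := by
    apply monotone_of_deriv_nonneg (fun x => (b x).differentiableAt)
    intro x
    rw [d x]
    exact mul_nonneg (hΓ.nonneg x) (hpos x).le
  refine ⟨hpos, strictMono_of_deriv_pos hdpos, deriv U c, c - U c / deriv U c, ?_, ?_⟩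
  · rw [← f (-c) le_rfl]
    exact hVm (by linarith)
  · intro ξ hξ
    have hV : ∀ t ∈ Icc c ξ, deriv U t = deriv U c := by
      refine mask_eq_of_deriv (f' := fun _ => 0) (g := fun _ => deriv U c) (fun t ht => ?_)
        (fun t _ => hasDerivWithinAt_const _ _ _) c (left_mem_Icc.2 hξ) rfl
      have h := (b t).hasDerivWithinAt (s := Icc c ξ)
      rwa [d t, hΓ.eq_zero t ht.1, zero_mul] at h
    have h := mask_eq_of_deriv (f := U) (f' := fun _ => deriv U c)
      (g := fun t => U c + deriv U c * (t - c)) (a := c) (b := ξ)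
      (fun t ht => by
        have h := (a t).hasDerivWithinAt (s := Icc c ξ)
        rwa [hV t ht] at h)
      (fun t _ => by
        have h := ((((hasDerivAt_id t).sub_const c).const_mul (deriv U c)).const_add (U c))
        rw [mul_one] at h
        exact h.hasDerivWithinAt) c (left_mem_Icc.2 hξ) (by simp) ξ (right_mem_Icc.2 hξ)
    rw [h]
    have := (hdpos c).ne'
    field_simp
    ring

/-- every compact mask possesses a unique decaying inner solution
(normalized to `e^ξ` in the solid), which is positive, strictly increasing, and
exactly affine `A (ξ - ℓ*)` in the fluid: the displacement length `ℓ*` is well defined. -/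
theorem compact_mask_displacement_length_exists {c : ℝ} (hc : 0 < c) {Γ : ℝ → ℝ}
    (hΓ : CompactMask c Γ) :
    (∃! U : ℝ → ℝ, ContDiff ℝ 2 U ∧ (∀ ξ : ℝ, deriv (deriv U) ξ = Γ ξ * U ξ) ∧
      (∀ ξ : ℝ, ξ ≤ -c → U ξ = Real.exp ξ)) ∧
    (∀ U : ℝ → ℝ, ContDiff ℝ 2 U → (∀ ξ : ℝ, deriv (deriv U) ξ = Γ ξ * U ξ) →
      (∀ ξ : ℝ, ξ ≤ -c → U ξ = Real.exp ξ) →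
      (∀ ξ : ℝ, 0 < U ξ) ∧ StrictMono U ∧
      ∃ A ℓstar : ℝ, Real.exp (-c) ≤ A ∧ ∀ ξ : ℝ, c ≤ ξ → U ξ = A * (ξ - ℓstar)) := by
  refine ⟨?_, fun U h d e => mask_props hc hΓ h d e⟩
  obtain ⟨U, h, d, e⟩ := mask_exists hc hΓ
  exact ⟨U, ⟨h, d, e⟩, fun W hW => mask_unique hΓ hW.1 hW.2.1 hW.2.2 h d e⟩
end

section
/- Let c > 0, δ > 0 and let Γ̂ : [−c, c] → ℝ be continuous with 0 ≤ Γ̂ ≤ 1. Then the solution R of the initial value problem R'(z) + R(z)² = δ²·Γ̂(z), R(−c) = δ exists on the whole interval [−c, c] (no finite-time blow-up) and satisfies δ/(1 + δ(z + c)) ≤ R(z) ≤ δ for all z ∈ [−c, c]; in particular 0 < R(z) ≤ δ throughout. -/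
open Real Filter Set

/-- Weak fencing lemma: if `f' ≤ B'` wherever `f ≥ B`, then `f` stays below `B`. -/
lemma riccati_fence {a b : ℝ} {f f' B B' : ℝ → ℝ}
    (hf : ∀ x ∈ Icc a b, HasDerivWithinAt f (f' x) (Icc a b) x)
    (hB : ∀ x ∈ Icc a b, HasDerivWithinAt B (B' x) (Icc a b) x)
    (ha : f a ≤ B a)
    (hle : ∀ x ∈ Icc a b, B x ≤ f x → f' x ≤ B' x) :
    ∀ x ∈ Icc a b, f x ≤ B x := by
  have right : ∀ {g : ℝ → ℝ} {g' x : ℝ}, x ∈ Ico a b →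
      HasDerivWithinAt g g' (Icc a b) x → HasDerivWithinAt g g' (Ici x) x := by
    intro g g' x hx h
    exact (h.mono (Icc_subset_Icc_left hx.1)).mono_of_mem_nhdsWithin (Icc_mem_nhdsGE hx.2)
  have key : ∀ ε : ℝ, 0 < ε → ∀ x ∈ Icc a b, f x ≤ B x + ε * (x - a) := by
    intro ε hε
    have hD : ∀ x ∈ Icc a b,
        HasDerivWithinAt (fun x => B x + ε * (x - a)) (B' x + ε) (Icc a b) x := by
      intro x hx
      have := (hB x hx).fun_add (((hasDerivWithinAt_id x (Icc a b)).sub_const a).const_mul ε)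
      simpa using this
    refine image_le_of_deriv_right_lt_deriv_boundary' (f' := f')
      (B' := fun x => B' x + ε)
      (fun x hx => (hf x hx).continuousWithinAt)
      (fun x hx => right hx (hf x (Ico_subset_Icc_self hx))) (by simpa using ha)
      (fun x hx => (hD x hx).continuousWithinAt)
      (fun x hx => right hx (hD x (Ico_subset_Icc_self hx))) ?_
    intro x hx he
    have h1 : 0 ≤ ε * (x - a) := mul_nonneg hε.le (by linarith [hx.1])
    have := hle x (Ico_subset_Icc_self hx) (by linarith)
    linarith
  intro x hx
  refine le_of_forall_pos_le_add fun η hη => ?_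
  have hxa : 0 ≤ x - a := by linarith [hx.1]
  have h := key (η / (x - a + 1)) (by positivity) x hx
  have h2 : η / (x - a + 1) * (x - a) ≤ η := by
    rw [div_mul_eq_mul_div, div_le_iff₀ (by positivity)]
    nlinarith
  linarith

/-- the Riccati initial value problem `R' + R² = δ² Γ̂`, `R(-c) = δ`
associated with the volume-penalty inner problem has a solution on all of `[-c, c]`
(no finite-time blow-up), satisfying `δ/(1 + δ(z+c)) ≤ R(z) ≤ δ`; in particular
`0 < R(z) ≤ δ` throughout. -/
theorem riccati_ivp_global_existence_and_bounds
    {c δ : ℝ} (hc : 0 < c) (hδ : 0 < δ)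
    {Γhat : ℝ → ℝ} (hΓc : ContinuousOn Γhat (Icc (-c) c))
    (hΓ0 : ∀ z ∈ Icc (-c) c, 0 ≤ Γhat z) (hΓ1 : ∀ z ∈ Icc (-c) c, Γhat z ≤ 1) :
    ∃ R : ℝ → ℝ,
      R (-c) = δ ∧
      (∀ z ∈ Icc (-c) c, HasDerivWithinAt R (δ ^ 2 * Γhat z - (R z) ^ 2) (Icc (-c) c) z) ∧
      (∀ z ∈ Icc (-c) c, δ / (1 + δ * (z + c)) ≤ R z ∧ R z ≤ δ) ∧
      (∀ z ∈ Icc (-c) c, 0 < R z) := by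
  have hcl0 : ∀ x : ℝ, 0 ≤ max 0 (min x δ) := fun x => le_max_left _ _
  have hcl1 : ∀ x : ℝ, max 0 (min x δ) ≤ δ := fun x => max_le hδ.le (min_le_right _ _)
  have hclL : ∀ x y : ℝ, |max 0 (min x δ) - max 0 (min y δ)| ≤ |x - y| := by
    intro x y
    have h1 := abs_max_sub_max_le_max 0 (min x δ) 0 (min y δ)
    have h2 := abs_min_sub_min_le_max x δ y δ
    simp only [sub_self, abs_zero] at h1 h2
    exact h1.trans (max_le (abs_nonneg _) (h2.trans (max_le le_rfl (abs_nonneg _))))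
  have hPL : IsPicardLindelof (fun t x => δ ^ 2 * Γhat t - (max 0 (min x δ)) ^ 2)
      (⟨-c, by constructor <;> linarith⟩ : Icc (-c) c) δ
      (⟨δ ^ 2 * (2 * c), by positivity⟩ : NNReal) 0 (⟨δ ^ 2, by positivity⟩ : NNReal)
      (⟨2 * δ, by positivity⟩ : NNReal) := by
    refine ⟨?_, ?_, ?_, ?_⟩
    · intro t ht
      refine LipschitzOnWith.of_dist_le_mul fun x _ y _ => ?_
      rw [Real.dist_eq, Real.dist_eq]
      change _ ≤ 2 * δ * |x - y|
      have e : δ ^ 2 * Γhat t - (max 0 (min x δ)) ^ 2 - (δ ^ 2 * Γhat t - (max 0 (min y δ)) ^ 2)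
          = -((max 0 (min x δ) + max 0 (min y δ)) * (max 0 (min x δ) - max 0 (min y δ))) := by ring
      rw [e, abs_neg, abs_mul, abs_of_nonneg (add_nonneg (hcl0 x) (hcl0 y))]
      exact mul_le_mul (by linarith [hcl1 x, hcl1 y]) (hclL x y) (abs_nonneg _) (by positivity)
    · intro x _
      exact (hΓc.const_smul (δ ^ 2)).sub continuousOn_const
    · intro t ht x _
      change |_| ≤ δ ^ 2
      have h1 := hcl0 x
      have h2 : (max 0 (min x δ)) ^ 2 ≤ δ ^ 2 := pow_le_pow_left₀ h1 (hcl1 x) 2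
      have h3 := mul_nonneg (sq_nonneg δ) (hΓ0 t ht)
      have h4 := mul_le_mul_of_nonneg_left (hΓ1 t ht) (sq_nonneg δ)
      rw [abs_le]
      constructor <;> nlinarith [sq_nonneg (max 0 (min x δ))]
    · change δ ^ 2 * max (c - -c) (-c - -c) ≤ δ ^ 2 * (2 * c) - 0
      rw [max_eq_left (by linarith)]
      apply le_of_eq
      ring
  obtain ⟨R, hR0, hR⟩ := hPL.exists_eq_forall_mem_Icc_hasDerivWithinAt₀
  simp only at hR0 hR
  have hpos : ∀ z ∈ Icc (-c) c, 0 < 1 + δ * (z + c) := by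
    intro z hz
    have : 0 ≤ δ * (z + c) := mul_nonneg hδ.le (by linarith [hz.1])
    linarith
  have hup : ∀ z ∈ Icc (-c) c, R z ≤ δ := by
    refine riccati_fence hR (B := fun _ => δ) (B' := fun _ => 0)
      (fun x _ => hasDerivWithinAt_const _ _ _) hR0.le ?_
    intro x hx h
    have h4 := mul_le_mul_of_nonneg_left (hΓ1 x hx) (sq_nonneg δ)
    rw [min_eq_right h, max_eq_right hδ.le]
    linarith
  have hlo : ∀ z ∈ Icc (-c) c, -R z ≤ -(δ / (1 + δ * (z + c))) := by
    refine riccati_fence (fun x hx => (hR x hx).neg) (B := fun z => -(δ / (1 + δ * (z + c))))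
      (B' := fun z => (δ / (1 + δ * (z + c))) ^ 2) ?_ ?_ ?_
    · intro x hx
      have hne := (hpos x hx).ne'
      have h1 : HasDerivAt (fun z => 1 + δ * (z + c)) δ x := by
        simpa using (((hasDerivAt_id x).add_const c).const_mul δ).const_add 1
      have h2 := (((hasDerivAt_const x δ).fun_div h1 hne).fun_neg).hasDerivWithinAt (s := Icc (-c) c)
      have e : -((0 * (1 + δ * (x + c)) - δ * δ) / (1 + δ * (x + c)) ^ 2)
          = (δ / (1 + δ * (x + c))) ^ 2 := by
        rw [div_pow]
        ring
      rw [e] at h2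
      exact h2
    · simp [hR0]
    · intro x hx h
      have hL : 0 ≤ δ / (1 + δ * (x + c)) := div_nonneg hδ.le (hpos x hx).le
      have h' : R x ≤ δ / (1 + δ * (x + c)) := by
        have : -(δ / (1 + δ * (x + c))) ≤ -R x := h
        linarith
      have h3 : max 0 (min (R x) δ) ≤ δ / (1 + δ * (x + c)) :=
        max_le hL ((min_le_left _ _).trans h')
      have h4 := pow_le_pow_left₀ (hcl0 (R x)) h3 2
      have h5 := mul_nonneg (sq_nonneg δ) (hΓ0 x hx)
      linarith
  have hRpos : ∀ z ∈ Icc (-c) c, 0 < R z := by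
    intro z hz
    have := hlo z hz
    have := div_pos hδ (hpos z hz)
    linarith
  refine ⟨R, hR0, ?_, fun z hz => ⟨by linarith [hlo z hz], hup z hz⟩, hRpos⟩
  intro z hz
  have h := hR z hz
  rwa [min_eq_left (hup z hz), max_eq_right (hRpos z hz).le] at h
end

section
/- Let c > 0, δ > 0, ℓ ∈ ℝ, and let Γ̂ : ℝ → ℝ be continuous with 0 ≤ Γ̂ ≤ 1, Γ̂(z) = 1 for z ≤ −c and Γ̂(z) = 0 for z ≥ c. Let U be the twice continuously differentiable solution of U''(ξ) = Γ̂((ξ − ℓ)/δ)·U(ξ) with U(ξ) = e^ξ for ξ ≤ ℓ − cδ, and let R solve R' + R² = δ²Γ̂ on [−c, c] with R(−c) = δ. Then there exists A > 0 such that U(ξ) = A·(ξ − ℓ*) for all ξ ≥ ℓ + cδ, where ℓ* = ℓ + cδ − δ/R(c). Consequently the displacement length ℓ* vanishes if and only if the shift is chosen as ℓ = (1/R(c) − c)·δ. -/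
open Real Filter Set

/-- for a rescaled compact mask `Γ̂((ξ-ℓ)/δ)`, the decaying inner solution `U`
(normalized to `e^ξ` in the solid) is affine `A (ξ - ℓ*)` in the fluid `ξ ≥ ℓ + cδ`, with
displacement length `ℓ* = ℓ + cδ - δ / R(c)` expressed in terms of the Riccati solution `R`;
consequently `ℓ* = 0` iff the shift is `ℓ = (1/R(c) - c) δ`. -/
theorem displacement_length_via_riccati
    {c δ ℓ : ℝ} (hc : 0 < c) (hδ : 0 < δ)
    {Γhat : ℝ → ℝ} (hΓc : Continuous Γhat)
    (hΓ0 : ∀ z, 0 ≤ Γhat z) (hΓ1 : ∀ z, Γhat z ≤ 1)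
    (hΓone : ∀ z : ℝ, z ≤ -c → Γhat z = 1) (hΓzero : ∀ z : ℝ, c ≤ z → Γhat z = 0)
    {U : ℝ → ℝ} (hU : ContDiff ℝ 2 U)
    (hUode : ∀ ξ : ℝ, deriv (deriv U) ξ = Γhat ((ξ - ℓ) / δ) * U ξ)
    (hUexp : ∀ ξ : ℝ, ξ ≤ ℓ - c * δ → U ξ = Real.exp ξ)
    {R : ℝ → ℝ} (hRinit : R (-c) = δ)
    (hRode : ∀ z ∈ Icc (-c) c,
      HasDerivWithinAt R (δ ^ 2 * Γhat z - (R z) ^ 2) (Icc (-c) c) z) :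
    (∃ A : ℝ, 0 < A ∧ ∀ ξ : ℝ, ℓ + c * δ ≤ ξ → U ξ = A * (ξ - (ℓ + c * δ - δ / R c))) ∧
    (ℓ + c * δ - δ / R c = 0 ↔ ℓ = (1 / R c - c) * δ) := by
  set a := ℓ - c * δ with ha
  set b := ℓ + c * δ with hb
  have hab : a ≤ b := by have := mul_pos hc hδ; linarith
  have hU1 : ContDiff ℝ 1 (deriv U) := by
    have h : ContDiff ℝ (1 + 1) U := by simpa [one_add_one_eq_two] using hU
    exact (contDiff_succ_iff_deriv.1 h).2.2
  have hd0 : ∀ x, HasDerivAt U (deriv U x) x := fun x =>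
    ((hU.differentiable (by norm_num)) x).hasDerivAt
  have hd1 : ∀ x, HasDerivAt (deriv U) (Γhat ((x - ℓ) / δ) * U x) x := fun x => by
    rw [← hUode]
    exact ((hU1.differentiable (by norm_num)) x).hasDerivAt
  have hUa : U a = Real.exp a := hUexp a le_rfl
  have hDa : deriv U a = Real.exp a := by
    have h1 : HasDerivWithinAt U (deriv U a) (Iic a) a := (hd0 a).hasDerivWithinAt
    have h2 : HasDerivWithinAt U (Real.exp a) (Iic a) a :=
      ((Real.hasDerivAt_exp a).hasDerivWithinAt).congr (fun x hx => hUexp x hx) hUa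
    exact (uniqueDiffWithinAt_Iic a).eq_deriv _ h1 h2
  have hP : ∀ x, HasDerivAt (fun y => U y * deriv U y)
      (deriv U x * deriv U x + U x * (Γhat ((x - ℓ) / δ) * U x)) x :=
    fun x => (hd0 x).mul (hd1 x)
  have hmono : Monotone (fun y => U y * deriv U y) := by
    apply monotone_of_deriv_nonneg (fun x => (hP x).differentiableAt)
    intro x
    rw [(hP x).deriv]
    nlinarith [mul_self_nonneg (deriv U x), mul_nonneg (hΓ0 ((x - ℓ) / δ)) (mul_self_nonneg (U x))]
  have hpos : ∀ x, a ≤ x → 0 < U x * deriv U x := fun x hx => by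
    have h := hmono hx
    simp only [hUa, hDa] at h
    have := mul_pos (Real.exp_pos a) (Real.exp_pos a)
    linarith
  have hUb : 0 < U b := by
    by_contra! hneg
    have h := intermediate_value_Icc' hab (hU.continuous.continuousOn (s := Icc a b))
    obtain ⟨x, hx, hx0⟩ := h ⟨hneg, by rw [hUa]; exact (Real.exp_pos a).le⟩
    have := hpos x hx.1
    simp [hx0] at this
  have hDb : 0 < deriv U b := by
    have := hpos b hab
    exact (pos_iff_pos_of_mul_pos this).1 hUb
  -- Riccati comparison
  have hRcont : ContinuousOn R (Icc (-c) c) := fun z hz => (hRode z hz).continuousWithinAt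
  obtain ⟨K, hK⟩ := isCompact_Icc.exists_bound_of_continuousOn hRcont
  have hlin : ∀ z : ℝ, HasDerivAt (fun y : ℝ => ℓ + δ * y) δ z := fun z => by
    simpa using ((hasDerivAt_id z).const_mul δ).const_add ℓ
  have hV : ∀ z : ℝ, HasDerivAt (fun y => U (ℓ + δ * y)) (deriv U (ℓ + δ * z) * δ) z := fun z =>
    (hd0 (ℓ + δ * z)).comp z (hlin z)
  have hW : ∀ z : ℝ, HasDerivAt (fun y => deriv U (ℓ + δ * y))
      (Γhat z * U (ℓ + δ * z) * δ) z := fun z => by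
    have h := (hd1 (ℓ + δ * z)).comp z (hlin z)
    have e : (ℓ + δ * z - ℓ) / δ = z := by field_simp; ring
    rw [e] at h
    exact h
  have hD : ∀ z ∈ Icc (-c) c, HasDerivWithinAt
      (fun y => δ * deriv U (ℓ + δ * y) - R y * U (ℓ + δ * y))
      (-R z * (δ * deriv U (ℓ + δ * z) - R z * U (ℓ + δ * z))) (Icc (-c) c) z := fun z hz => by
    have h := (((hW z).const_mul δ).hasDerivWithinAt (s := Icc (-c) c)).sub
      ((hRode z hz).mul (hV z).hasDerivWithinAt)
    refine h.congr_deriv ?_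
    ring
  have hzero : δ * deriv U (ℓ + δ * c) - R c * U (ℓ + δ * c) = 0 := by
    refine eq_zero_of_abs_deriv_le_mul_abs_self_of_eq_zero_right (K := K) (a := -c) (b := c)
      (f := fun y => δ * deriv U (ℓ + δ * y) - R y * U (ℓ + δ * y))
      (f' := fun z => -R z * (δ * deriv U (ℓ + δ * z) - R z * U (ℓ + δ * z)))
      (fun z hz => (hD z hz).continuousWithinAt) ?_ ?_ ?_ c ⟨by linarith, le_rfl⟩
    · intro z hz
      exact (hD z (Ico_subset_Icc_self hz)).mono_of_mem_nhdsWithin (Icc_mem_nhdsGE_of_mem hz)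
    · have e : ℓ + δ * -c = a := by rw [ha]; ring
      simp only [e, hUa, hDa, hRinit]
      ring
    · intro z hz
      rw [norm_mul, norm_neg]
      exact mul_le_mul_of_nonneg_right (hK z (Ico_subset_Icc_self hz)) (norm_nonneg _)
  have eb : ℓ + δ * c = b := by rw [hb]; ring
  rw [eb] at hzero
  have hRc : R c = δ * deriv U b / U b := by
    field_simp
    linarith
  have hdiv : δ / R c = U b / deriv U b := by
    rw [hRc]; field_simp
  constructor
  · refine ⟨deriv U b, hDb, fun ξ hξ => ?_⟩
    have hz : ∀ x, b ≤ x → HasDerivAt (deriv U) 0 x := fun x hx => by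
      have h := hd1 x
      rw [hΓzero _ (by rw [le_div_iff₀ hδ]; linarith), zero_mul] at h
      exact h
    have hconst : ∀ x, b ≤ x → deriv U x = deriv U b := fun x hx =>
      constant_of_has_deriv_right_zero hU1.continuous.continuousOn
        (fun y hy => (hz y hy.1).hasDerivWithinAt) x ⟨hx, le_rfl⟩
    have hf : ∀ x, HasDerivAt (fun y => U y - deriv U b * y) (deriv U x - deriv U b) x := fun x => by
      have h := (hd0 x).sub ((hasDerivAt_id x).const_mul (deriv U b))
      rw [mul_one] at h
      exact h
    have h2 := constant_of_has_deriv_right_zero (a := b) (b := ξ)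
      (f := fun y => U y - deriv U b * y)
      (fun y _ => (hf y).continuousAt.continuousWithinAt)
      (fun y hy => by
        have h := hf y
        rw [hconst y hy.1, sub_self] at h
        exact h.hasDerivWithinAt) ξ ⟨hξ, le_rfl⟩
    rw [hdiv]
    field_simp
    linarith
  · have e : (1 / R c - c) * δ = δ / R c - c * δ := by ring
    rw [e, hb]
    constructor <;> intro h <;> linarith
end

section
/- Let c > 0 and let Γ̂ : ℝ → ℝ be continuous with 0 ≤ Γ̂ ≤ 1, Γ̂(z) = 1 for z ≤ −c and Γ̂(z) = 0 for z ≥ c. For each δ > 0 let R_δ denote the solution of R' + R² = δ²Γ̂ on [−c, c] with R_δ(−c) = δ, and define the optimal shift ℓ*(δ) = (1/R_δ(c) − c)·δ. Then 1 − cδ ≤ ℓ*(δ) ≤ 1 + cδ for all δ > 0, and in particular ℓ*(δ) → 1 as δ → 0⁺, recovering the optimal shift of the discontinuous mask. -/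
open Real Filter Set


/-- Linear comparison with an integrating factor. -/
lemma linear_comparison {a b : ℝ} (hab : a ≤ b) {u v S : ℝ → ℝ}
    (hu : ∀ z ∈ Icc a b, HasDerivWithinAt u (v z) (Icc a b) z)
    (hS : ContinuousOn S (Icc a b))
    (hv : ∀ z ∈ Icc a b, 0 ≤ v z + S z * u z) (h0 : 0 ≤ u a) : 0 ≤ u b := by
  have hT : Continuous (IccExtend hab ((Icc a b).domRestrict S)) :=
    (continuousOn_iff_continuous_domRestrict.mp hS).Icc_extend'
  set T := IccExtend hab ((Icc a b).domRestrict S) with hTdef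
  have hTS : ∀ z ∈ Icc a b, T z = S z := fun z hz => by
    rw [hTdef, IccExtend_of_mem _ _ hz]; rfl
  have hI : ∀ z, HasDerivAt (fun z => Real.exp (∫ t in a..z, T t))
      (Real.exp (∫ t in a..z, T t) * T z) z := fun z =>
    (hT.integral_hasStrictDerivAt a z).hasDerivAt.exp
  have hd : ∀ z ∈ Icc a b, HasDerivWithinAt (fun z => u z * Real.exp (∫ t in a..z, T t))
      (v z * Real.exp (∫ t in a..z, T t) + u z * (Real.exp (∫ t in a..z, T t) * T z))
      (Icc a b) z := fun z hz => (hu z hz).mul (hI z).hasDerivWithinAt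
  have hm : MonotoneOn (fun z => u z * Real.exp (∫ t in a..z, T t)) (Icc a b) := by
    refine monotoneOn_of_hasDerivWithinAt_nonneg (convex_Icc a b)
      (fun z hz => (hd z hz).continuousWithinAt)
      (fun z hz => (hd z (interior_subset hz)).mono interior_subset) ?_
    intro z hz
    have hz' := interior_subset hz
    rw [hTS z hz']
    have := mul_nonneg (hv z hz') (Real.exp_pos (∫ t in a..z, T t)).le
    linarith
  have h := hm (left_mem_Icc.mpr hab) (right_mem_Icc.mpr hab) hab
  simp only [intervalIntegral.integral_same, Real.exp_zero, mul_one] at h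
  exact nonneg_of_mul_nonneg_left (h0.trans h) (Real.exp_pos _)

/-- for a compact normalized mask profile `Γ̂`, the optimal shift
`ℓ*(δ) = (1/R_δ(c) - c) δ` computed from the Riccati solution `R_δ` (with `R_δ(-c) = δ`)
satisfies `1 - cδ ≤ ℓ*(δ) ≤ 1 + cδ`, and hence `ℓ*(δ) → 1` as `δ → 0⁺`, recovering the
optimal shift of the discontinuous mask. -/
theorem optimal_shift_bounds_and_limit
    {c : ℝ} (hc : 0 < c)
    {Γhat : ℝ → ℝ} (hΓc : Continuous Γhat)
    (hΓ0 : ∀ z, 0 ≤ Γhat z) (hΓ1 : ∀ z, Γhat z ≤ 1)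
    (hΓone : ∀ z : ℝ, z ≤ -c → Γhat z = 1) (hΓzero : ∀ z : ℝ, c ≤ z → Γhat z = 0)
    (L : ℝ → ℝ)
    (hL : ∀ δ : ℝ, 0 < δ → ∃ R : ℝ → ℝ,
      R (-c) = δ ∧
      (∀ z ∈ Icc (-c) c,
        HasDerivWithinAt R (δ ^ 2 * Γhat z - (R z) ^ 2) (Icc (-c) c) z) ∧
      L δ = (1 / R c - c) * δ) :
    (∀ δ : ℝ, 0 < δ → 1 - c * δ ≤ L δ ∧ L δ ≤ 1 + c * δ) ∧
    Tendsto L (nhdsWithin 0 (Ioi 0)) (nhds 1) := by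
  have key : ∀ δ : ℝ, 0 < δ → 1 - c * δ ≤ L δ ∧ L δ ≤ 1 + c * δ := by
    intro δ hδ
    obtain ⟨R, hR0, hR, hLδ⟩ := hL δ hδ
    have hcc : -c ≤ c := by linarith
    have hRc : ContinuousOn R (Icc (-c) c) := fun z hz => (hR z hz).continuousWithinAt
    have hup : 0 ≤ δ - R c := by
      refine linear_comparison (u := fun z => δ - R z) (S := fun z => R z + δ) hcc
        (fun z hz => (hR z hz).const_sub δ) (hRc.add continuousOn_const) ?_ ?_
      · intro z hz
        have := mul_nonneg (sq_nonneg δ) (sub_nonneg.mpr (hΓ1 z))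
        linarith
      · simp [hR0]
    have hpos : ∀ z ∈ Icc (-c) c, 0 < 1 + δ * (z + c) := by
      intro z hz
      have := mul_nonneg hδ.le (by linarith [hz.1] : 0 ≤ z + c)
      linarith
    have hB : ∀ z ∈ Icc (-c) c, HasDerivWithinAt (fun z => δ / (1 + δ * (z + c)))
        (-(δ / (1 + δ * (z + c))) ^ 2) (Icc (-c) c) z := by
      intro z hz
      have h1 : HasDerivAt (fun z => 1 + δ * (z + c)) (δ * 1) z :=
        (((hasDerivAt_id z).add_const c).const_mul δ).const_add 1
      have h2 := (hasDerivAt_const z δ).fun_div h1 (hpos z hz).ne'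
      have e : (0 * (1 + δ * (z + c)) - δ * (δ * 1)) / (1 + δ * (z + c)) ^ 2
          = -(δ / (1 + δ * (z + c))) ^ 2 := by
        rw [div_pow]; ring
      rw [e] at h2
      exact h2.hasDerivWithinAt
    have hlow : 0 ≤ R c - δ / (1 + δ * (c + c)) := by
      refine linear_comparison (u := fun z => R z - δ / (1 + δ * (z + c)))
        (S := fun z => R z + δ / (1 + δ * (z + c))) hcc
        (fun z hz => (hR z hz).sub (hB z hz))
        (hRc.add (fun z hz => (hB z hz).continuousWithinAt)) ?_ ?_
      · intro z hz
        have := mul_nonneg (sq_nonneg δ) (hΓ0 z)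
        linarith
      · simp [hR0]
    have hd := hpos c (right_mem_Icc.mpr hcc)
    have hRpos : 0 < R c := by
      have := div_pos hδ hd
      linarith
    have e : L δ = δ / R c - c * δ := by rw [hLδ]; ring
    have l1 : 1 ≤ δ / R c := (one_le_div hRpos).mpr (by linarith)
    have l2 : δ / R c ≤ 1 + δ * (c + c) := by
      rw [div_le_iff₀ hRpos]
      have := (div_le_iff₀ hd).mp (sub_nonneg.mp hlow)
      linarith
    constructor <;> linarith
  refine ⟨key, ?_⟩
  have t1 : Tendsto (fun δ : ℝ => 1 - c * δ) (nhdsWithin 0 (Ioi 0)) (nhds 1) := by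
    have : Continuous (fun δ : ℝ => 1 - c * δ) := by fun_prop
    simpa using (this.tendsto 0).mono_left nhdsWithin_le_nhds
  have t2 : Tendsto (fun δ : ℝ => 1 + c * δ) (nhdsWithin 0 (Ioi 0)) (nhds 1) := by
    have : Continuous (fun δ : ℝ => 1 + c * δ) := by fun_prop
    simpa using (this.tendsto 0).mono_left nhdsWithin_le_nhds
  refine tendsto_of_tendsto_of_tendsto_of_le_of_le' t1 t2 ?_ ?_
  · filter_upwards [self_mem_nhdsWithin] with δ hδ using (key δ hδ).1
  · filter_upwards [self_mem_nhdsWithin] with δ hδ using (key δ hδ).2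
end

section
/- Fix n > 0 and define U : [0, 1) → ℝ by the Frobenius series U(z) = (1/2)·∑_{k=0}^∞ [Γ(k+n)·Γ(k+n+1) / (Γ(k+2n+1)·k!)]·z^{k+n}, where Γ denotes the real Gamma function. Then the series converges for every z ∈ [0, 1), U(0) = 0, U is twice continuously differentiable on (0, 1), and U satisfies the hypergeometric-type ODE (1 − z)·z²·U''(z) + (1 − 2z)·z·U'(z) − n²·U(z) = 0 on (0, 1). -/
open Real Filter Set

/-- The Frobenius series solution of the inner problem for the tanh mask, in the
variable `z = (1 + tanh(2ξ/δ))/2`, with `n = δ/4` and `Γ` the real Gamma function. -/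
noncomputable def frobU (n : ℝ) : ℝ → ℝ := fun z =>
  (1 / 2) * ∑' k : ℕ,
    (Real.Gamma (k + n) * Real.Gamma (k + n + 1) /
      (Real.Gamma (k + 2 * n + 1) * (Nat.factorial k))) * z ^ ((k : ℝ) + n)

/-- Coefficients whose power series converges absolutely on the unit disc. -/
def FrobS (a : ℕ → ℝ) : Prop := ∀ r ∈ Ioo (0 : ℝ) 1, Summable (fun k : ℕ => |a k| * r ^ k)

/-- The generalized power series with shift `s`. -/
noncomputable def FrobF (a : ℕ → ℝ) (s : ℝ) : ℝ → ℝ := fun z => ∑' k : ℕ, a k * z ^ ((k : ℝ) + s)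

lemma FrobS.mul_lin {a : ℕ → ℝ} (ha : FrobS a) (s : ℝ) :
    FrobS (fun k => a k * ((k : ℝ) + s)) := by
  intro r hr
  have hr' : (r + 1) / 2 ∈ Ioo (0 : ℝ) 1 := ⟨by linarith [hr.1], by linarith [hr.2]⟩
  set t := (r + 1) / 2 with ht
  have hq : |r / t| < 1 := by
    rw [abs_of_pos (div_pos hr.1 hr'.1), div_lt_one hr'.1]; linarith [hr.2]
  have h1 := tendsto_self_mul_const_pow_of_abs_lt_one hq
  have h2 := (tendsto_pow_atTop_nhds_zero_of_abs_lt_one hq).const_mul s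
  have h3 : Tendsto (fun k : ℕ => ((k : ℝ) + s) * (r / t) ^ k) atTop (nhds 0) := by
    have := h1.add h2
    simp only [mul_zero, add_zero] at this
    refine this.congr (fun k => by ring)
  have h4 : (fun k : ℕ => ((k : ℝ) + s) * (r / t) ^ k) =O[atTop] (fun _ => (1 : ℝ)) :=
    h3.isBigO_one ℝ
  have h5 := (Asymptotics.isBigO_refl (fun k : ℕ => |a k| * t ^ k) atTop).mul h4
  refine summable_of_isBigO_nat (ha t hr') ?_
  refine Asymptotics.IsBigO.congr_right (Asymptotics.IsBigO.trans (Asymptotics.IsBigO.of_bound 1 ?_) h5)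
    (fun k => by ring)
  refine Eventually.of_forall (fun k => le_of_eq ?_)
  have htp : t ≠ 0 := hr'.1.ne'
  simp only [Real.norm_eq_abs, abs_mul, abs_abs, abs_pow, abs_div, one_mul, div_pow]
  have : |t| ^ k ≠ 0 := pow_ne_zero _ (abs_ne_zero.mpr htp)
  field_simp

lemma FrobS.summable {a : ℕ → ℝ} (ha : FrobS a) (s : ℝ) {z : ℝ} (hz : z ∈ Ioo (0 : ℝ) 1) :
    Summable (fun k : ℕ => a k * z ^ ((k : ℝ) + s)) := by
  have h := (ha z hz).mul_right (z ^ s)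
  refine Summable.of_norm (h.congr (fun k => ?_))
  rw [Real.norm_eq_abs, abs_mul, abs_of_pos (rpow_pos_of_pos hz.1 _), rpow_add hz.1, rpow_natCast]
  ring

lemma FrobS.hasDerivAt {a : ℕ → ℝ} (ha : FrobS a) (s : ℝ) {z : ℝ} (hz : z ∈ Ioo (0 : ℝ) 1) :
    HasDerivAt (FrobF a s) (FrobF (fun k => a k * ((k : ℝ) + s)) (s - 1) z) z := by
  have hl : 0 < z / 2 := by linarith [hz.1]
  have ht : (z + 1) / 2 ∈ Ioo (0 : ℝ) 1 := ⟨by linarith [hz.1], by linarith [hz.2]⟩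
  have hzmem : z ∈ Ioo (z / 2) ((z + 1) / 2) := ⟨by linarith [hz.1], by linarith [hz.2]⟩
  have hu := ((ha.mul_lin s) _ ht).mul_right ((z / 2) ^ (-|s - 1|))
  refine hasDerivAt_tsum_of_isPreconnected hu isOpen_Ioo isPreconnected_Ioo
    (g := fun k y => a k * y ^ ((k : ℝ) + s))
    (g' := fun k y => a k * ((k : ℝ) + s) * y ^ ((k : ℝ) + (s - 1))) ?_ ?_ hzmem
    (ha.summable s hz) hzmem
  · intro k y hy
    have hy0 : 0 < y := hl.trans hy.1
    have := (Real.hasDerivAt_rpow_const (x := y) (p := (k : ℝ) + s) (Or.inl hy0.ne')).const_mul (a k)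
    rw [← mul_assoc, add_sub_assoc] at this
    exact this
  · intro k y hy
    have hy0 : 0 < y := hl.trans hy.1
    have hy1 : y < 1 := hy.2.trans ht.2
    rw [Real.norm_eq_abs, abs_mul, abs_of_pos (rpow_pos_of_pos hy0 _), rpow_add hy0, rpow_natCast,
      ← mul_assoc]
    have e1 : y ^ (s - 1) ≤ (z / 2) ^ (-|s - 1|) :=
      (rpow_le_rpow_of_exponent_ge hy0 hy1.le (neg_abs_le _)).trans
        (rpow_le_rpow_of_nonpos hl hy.1.le (neg_nonpos.mpr (abs_nonneg _)))
    have e2 : y ^ k ≤ ((z + 1) / 2) ^ k := pow_le_pow_left₀ hy0.le hy.2.le k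
    have e3 : 0 ≤ y ^ (s - 1) := (rpow_pos_of_pos hy0 _).le
    have e4 : 0 ≤ ((z + 1) / 2) ^ k := pow_nonneg ht.1.le k
    gcongr

lemma FrobS.contDiffOn (m : ℕ) : ∀ {a : ℕ → ℝ} (_ : FrobS a) (s : ℝ),
    ContDiffOn ℝ m (FrobF a s) (Ioo 0 1) := by
  induction m with
  | zero =>
    intro a ha s
    exact contDiffOn_zero.mpr (fun z hz => (ha.hasDerivAt s hz).continuousAt.continuousWithinAt)
  | succ m ih =>
    intro a ha s
    push_cast
    rw [contDiffOn_succ_iff_deriv_of_isOpen isOpen_Ioo]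
    refine ⟨fun z hz => (ha.hasDerivAt s hz).differentiableAt.differentiableWithinAt, by simp, ?_⟩
    exact (ih (ha.mul_lin s) (s - 1)).congr (fun z hz => (ha.hasDerivAt s hz).deriv)

/-- The Frobenius coefficients. -/
noncomputable def frobA (n : ℝ) (k : ℕ) : ℝ :=
  Real.Gamma (k + n) * Real.Gamma (k + n + 1) /
      (Real.Gamma (k + 2 * n + 1) * (Nat.factorial k))

lemma frobA_pos {n : ℝ} (hn : 0 < n) (k : ℕ) : 0 < frobA n k := by
  unfold frobA
  have h1 := Real.Gamma_pos_of_pos (s := k + n) (by positivity)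
  have h2 := Real.Gamma_pos_of_pos (s := k + n + 1) (by positivity)
  have h3 := Real.Gamma_pos_of_pos (s := k + 2 * n + 1) (by positivity)
  positivity

lemma frobA_succ {n : ℝ} (hn : 0 < n) (k : ℕ) :
    frobA n (k + 1) * (((k : ℝ) + 1) * (k + 1 + 2 * n)) =
      frobA n k * ((k + n) * (k + n + 1)) := by
  unfold frobA
  have h1 : Real.Gamma ((k + 1 : ℕ) + n) = (k + n) * Real.Gamma (k + n) := by
    rw [← Real.Gamma_add_one (by positivity)]; congr 1; push_cast; ring
  have h2 : Real.Gamma ((k + 1 : ℕ) + n + 1) = (k + n + 1) * Real.Gamma (k + n + 1) := by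
    rw [← Real.Gamma_add_one (by positivity)]; congr 1; push_cast; ring
  have h3 : Real.Gamma ((k + 1 : ℕ) + 2 * n + 1) = (k + 2 * n + 1) * Real.Gamma (k + 2 * n + 1) := by
    rw [← Real.Gamma_add_one (by positivity)]; congr 1; push_cast; ring
  have h4 := (Real.Gamma_pos_of_pos (s := k + 2 * n + 1) (by positivity)).ne'
  have h5 : (k.factorial : ℝ) ≠ 0 := by positivity
  have h6 : (k : ℝ) + 2 * n + 1 ≠ 0 := by positivity
  have h7 : (k : ℝ) + 1 ≠ 0 := by positivity
  rw [h1, h2, h3, Nat.factorial_succ]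
  push_cast
  generalize Real.Gamma (k + 2 * n + 1) = G at *
  generalize (k.factorial : ℝ) = f at *
  field_simp
  ring

lemma frobA_S {n : ℝ} (hn : 0 < n) : FrobS (frobA n) := by
  intro r hr
  have hlim : ∀ c d : ℝ, Tendsto (fun k : ℕ => ((k : ℝ) + c) / (k + d)) atTop (nhds 1) := by
    intro c d
    simpa [add_comm] using tendsto_add_mul_div_add_mul_atTop_nhds c d (1 : ℝ) (one_ne_zero)
  have h := ((hlim n 1).mul (hlim (n + 1) (1 + 2 * n))).mul_const r
  simp only [one_mul] at h
  refine summable_of_ratio_test_tendsto_lt_one (l := r) hr.2 ?_ ?_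
  · exact Eventually.of_forall fun k =>
      mul_ne_zero (abs_ne_zero.mpr (frobA_pos hn k).ne') (pow_ne_zero _ hr.1.ne')
  · refine h.congr (fun k => ?_)
    have e := frobA_succ hn k
    have p0 := frobA_pos hn k
    have p1 := frobA_pos hn (k + 1)
    have h6 : (k : ℝ) + (1 + 2 * n) ≠ 0 := by positivity
    have h7 : (k : ℝ) + 1 ≠ 0 := by positivity
    have hr0 := hr.1
    simp only [Real.norm_eq_abs, abs_mul, abs_abs, abs_pow, abs_of_pos hr0, abs_of_pos p0,
      abs_of_pos p1]
    have p0' := p0.ne'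
    field_simp
    rw [pow_succ]
    linear_combination (-r ^ k * r) * e

/-- the Frobenius series converges on `[0,1)`, vanishes at `0`, is twice
continuously differentiable on `(0,1)`, and solves the hypergeometric-type ODE
`(1-z) z² U'' + (1-2z) z U' - n² U = 0` there. -/
theorem frobenius_series_solves_hypergeometric_ode {n : ℝ} (hn : 0 < n) :
    (∀ z ∈ Ico (0 : ℝ) 1, Summable (fun k : ℕ =>
      (Real.Gamma (k + n) * Real.Gamma (k + n + 1) /
        (Real.Gamma (k + 2 * n + 1) * (Nat.factorial k))) * z ^ ((k : ℝ) + n))) ∧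
    frobU n 0 = 0 ∧
    ContDiffOn ℝ 2 (frobU n) (Ioo 0 1) ∧
    (∀ z ∈ Ioo (0 : ℝ) 1,
      (1 - z) * z ^ 2 * deriv (deriv (frobU n)) z
        + (1 - 2 * z) * z * deriv (frobU n) z - n ^ 2 * frobU n z = 0) := by
  have hS := frobA_S hn
  have hU : frobU n = fun z => (1 / 2) * FrobF (frobA n) n z := rfl
  refine ⟨?_, ?_, ?_, ?_⟩
  · intro z hz
    rcases hz.1.eq_or_lt with h0 | h0
    · subst h0
      refine summable_zero.congr (fun k => ?_)
      rw [zero_rpow (by positivity), mul_zero]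
    · exact hS.summable n ⟨h0, hz.2⟩
  · unfold frobU
    have : ∀ k : ℕ, (0 : ℝ) ^ ((k : ℝ) + n) = 0 := fun k => zero_rpow (by positivity)
    simp [this]
  · rw [hU]
    exact contDiffOn_const.mul (hS.contDiffOn 2 n)
  · intro z hz
    have hd : ∀ y ∈ Ioo (0 : ℝ) 1, deriv (frobU n) y =
        (1 / 2) * FrobF (fun k => frobA n k * ((k : ℝ) + n)) (n - 1) y := by
      intro y hy
      rw [hU]
      exact ((hS.hasDerivAt n hy).const_mul (1 / 2)).deriv
    have hd2 : deriv (deriv (frobU n)) z = (1 / 2) *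
        FrobF (fun k => frobA n k * ((k : ℝ) + n) * ((k : ℝ) + (n - 1))) (n - 1 - 1) z := by
      have : deriv (frobU n) =ᶠ[nhds z] fun y =>
          (1 / 2) * FrobF (fun k => frobA n k * ((k : ℝ) + n)) (n - 1) y :=
        Filter.eventuallyEq_of_mem (isOpen_Ioo.mem_nhds hz) hd
      rw [this.deriv_eq]
      exact (((hS.mul_lin n).hasDerivAt (n - 1) hz).const_mul (1 / 2)).deriv
    rw [hd2, hd z hz, hU]
    have hz0 := hz.1
    have hs0 := hS.summable n hz
    have hs1 := (hS.mul_lin n).summable n hz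
    have hs2 := ((hS.mul_lin n).mul_lin (n - 1)).summable n hz
    have e1 : z * FrobF (fun k => frobA n k * ((k : ℝ) + n)) (n - 1) z =
        FrobF (fun k => frobA n k * ((k : ℝ) + n)) n z := by
      unfold FrobF
      rw [← tsum_mul_left]
      refine tsum_congr (fun k => ?_)
      have : z ^ ((k : ℝ) + n) = z ^ ((k : ℝ) + (n - 1)) * z := by
        rw [← rpow_add_one hz0.ne']; congr 1; ring
      rw [this]; ring
    have e2 : z ^ 2 * FrobF (fun k => frobA n k * ((k : ℝ) + n) * ((k : ℝ) + (n - 1))) (n - 1 - 1) z =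
        FrobF (fun k => frobA n k * ((k : ℝ) + n) * ((k : ℝ) + (n - 1))) n z := by
      unfold FrobF
      rw [← tsum_mul_left]
      refine tsum_congr (fun k => ?_)
      have : z ^ ((k : ℝ) + n) = z ^ ((k : ℝ) + (n - 1 - 1)) * z * z := by
        rw [← rpow_add_one hz0.ne', ← rpow_add_one hz0.ne']; congr 1; ring
      rw [this]; ring
    have hA := (hs2.hasSum.add hs1.hasSum).sub (hs0.hasSum.mul_left (n ^ 2))
    have hB := (hs2.hasSum.add (hs1.hasSum.mul_left 2)).mul_left z
    have hA' := (hasSum_nat_add_iff' 1).mpr hA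
    have key := HasSum.unique hA' ((congrArg (fun f => HasSum f _) (funext fun k => by
      have e := frobA_succ hn k
      have : z ^ (((k + 1 : ℕ) : ℝ) + n) = z ^ ((k : ℝ) + n) * z := by
        rw [← rpow_add_one hz0.ne']; congr 1; push_cast; ring
      rw [this]
      push_cast
      linear_combination (z ^ ((k : ℝ) + n) * z) * e)).mpr hB)
    simp only [Finset.sum_range_one] at key
    push_cast at key
    simp only [FrobF] at e1 e2 ⊢
    linear_combination (1 / 2 * (1 - z)) * e2 + (1 / 2 * (1 - 2 * z)) * e1 + 1 / 2 * key
end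

section
/- Fix n > 0, set δ = 4n, and define z : ℝ → (0, 1) by z(ξ) = (1 + tanh(2ξ/δ))/2 and the tanh mask Γ_tanh(ξ) = (1 − tanh(2ξ/δ))/2. If U : (0, 1) → ℝ is twice continuously differentiable and satisfies (1 − z)·z²·U''(z) + (1 − 2z)·z·U'(z) − n²·U(z) = 0 on (0, 1), then u(ξ) := U(z(ξ)) is twice continuously differentiable on ℝ and satisfies the inner problem u''(ξ) = Γ_tanh(ξ)·u(ξ) for all ξ ∈ ℝ. -/
open Real Filter Set

/-- under the change of variables `z(ξ) = (1 + tanh(2ξ/δ))/2` with `δ = 4n`,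
any `C²` solution of the hypergeometric-type ODE `(1-z) z² U'' + (1-2z) z U' - n² U = 0`
on `(0,1)` pulls back to a `C²` solution of the inner problem `u'' = Γ_tanh u` for the
hyperbolic tangent mask `Γ_tanh(ξ) = (1 - tanh(2ξ/δ))/2`. -/
theorem hypergeometric_pullback_solves_tanh_inner_problem
    {n : ℝ} (hn : 0 < n) {δ : ℝ} (hδ : δ = 4 * n)
    (z : ℝ → ℝ) (hz : z = fun ξ => (1 + Real.tanh (2 * ξ / δ)) / 2)
    (Γtanh : ℝ → ℝ) (hΓ : Γtanh = fun ξ => (1 - Real.tanh (2 * ξ / δ)) / 2)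
    {U : ℝ → ℝ} (hU : ContDiffOn ℝ 2 U (Ioo 0 1))
    (hUode : ∀ w ∈ Ioo (0 : ℝ) 1,
      (1 - w) * w ^ 2 * deriv (deriv U) w
        + (1 - 2 * w) * w * deriv U w - n ^ 2 * U w = 0)
    (u : ℝ → ℝ) (hu : u = fun ξ => U (z ξ)) :
    ContDiff ℝ 2 u ∧ ∀ ξ : ℝ, deriv (deriv u) ξ = Γtanh ξ * u ξ := by
  have hzmem : ∀ ξ, z ξ ∈ Ioo (0 : ℝ) 1 := by
    intro ξ
    have h1 := Real.tanh_lt_one (2 * ξ / δ)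
    have h2 := Real.neg_one_lt_tanh (2 * ξ / δ)
    rw [hz]
    constructor <;> dsimp only <;> linarith
  have hn0 : n ≠ 0 := hn.ne'
  have hzc : ContDiff ℝ 2 z := by
    have h : z = fun ξ => (1 + Real.sinh (2 * ξ / δ) / Real.cosh (2 * ξ / δ)) / 2 := by
      rw [hz]
      funext ξ
      rw [Real.tanh_eq_sinh_div_cosh]
    rw [h]
    have hl : ContDiff ℝ 2 (fun ξ : ℝ => 2 * ξ / δ) := by fun_prop
    exact (contDiff_const.add ((Real.contDiff_sinh.comp hl).div (Real.contDiff_cosh.comp hl)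
      (fun ξ => (Real.cosh_pos _).ne'))).div_const 2
  have hzd : ∀ ξ, HasDerivAt z (z ξ * (1 - z ξ) / n) ξ := by
    intro ξ
    have h : z = fun ξ => (1 + Real.sinh (2 * ξ / δ) / Real.cosh (2 * ξ / δ)) / 2 := by
      rw [hz]
      funext ξ
      rw [Real.tanh_eq_sinh_div_cosh]
    rw [h]
    have hl : HasDerivAt (fun ξ : ℝ => 2 * ξ / δ) (2 * 1 / δ) ξ :=
      ((hasDerivAt_id ξ).const_mul 2).div_const δ
    have hc := (Real.cosh_pos (2 * ξ / δ)).ne'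
    have hmain := (((hl.sinh).div (hl.cosh) hc).const_add 1).div_const 2
    refine hmain.congr_deriv ?_
    have hδ0 : δ ≠ 0 := by rw [hδ]; positivity
    have hnδ : n = δ / 4 := by rw [hδ]; ring
    rw [hnδ]
    field_simp
    ring
  have hUat : ∀ w ∈ Ioo (0 : ℝ) 1, ContDiffAt ℝ 2 U w := fun w hw =>
    hU.contDiffAt (isOpen_Ioo.mem_nhds hw)
  have hU1 : ∀ w ∈ Ioo (0 : ℝ) 1, HasDerivAt U (deriv U w) w := fun w hw =>
    ((hUat w hw).differentiableAt (by norm_num)).hasDerivAt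
  have hdU : ContDiffOn ℝ 1 (deriv U) (Ioo 0 1) :=
    hU.deriv_of_isOpen isOpen_Ioo (by norm_num)
  have hU2 : ∀ w ∈ Ioo (0 : ℝ) 1, HasDerivAt (deriv U) (deriv (deriv U) w) w := fun w hw =>
    ((hdU.contDiffAt (isOpen_Ioo.mem_nhds hw)).differentiableAt (by norm_num)).hasDerivAt
  refine ⟨?_, ?_⟩
  · rw [hu, contDiff_iff_contDiffAt]
    intro ξ
    exact (hUat _ (hzmem ξ)).comp ξ hzc.contDiffAt
  · have hu1 : deriv u = fun ξ => deriv U (z ξ) * (z ξ * (1 - z ξ) / n) := by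
      funext ξ
      rw [hu]
      exact ((hU1 _ (hzmem ξ)).comp ξ (hzd ξ)).deriv
    intro ξ
    have h2 := ((hU2 _ (hzmem ξ)).comp ξ (hzd ξ)).mul
      (((hzd ξ).mul ((hzd ξ).const_sub 1)).div_const n)
    have hΓz : Γtanh ξ = 1 - z ξ := by
      rw [hΓ, hz]
      ring
    have hode := hUode _ (hzmem ξ)
    rw [hu1]
    refine h2.deriv.trans ?_
    rw [hΓz, hu]
    simp only [Function.comp, Pi.mul_apply]
    field_simp
    linear_combination (1 - z ξ) * hode
end

section
/- Fix n > 0 and set δ = 4n. Let U : [0, 1) → ℝ be the Frobenius series U(z) = (1/2)·∑_{k=0}^∞ [Γ(k+n)·Γ(k+n+1) / (Γ(k+2n+1)·k!)]·z^{k+n}, let z(ξ) = (1 + tanh(2ξ/δ))/2, and let u(ξ) = U(z(ξ)) be the corresponding decaying solution of the inner problem for the tanh mask. Then u(ξ) − ξ/(2n) converges as ξ → +∞ and lim_{ξ→∞} (u(ξ) − ξ/(2n)) = −σ(n), where σ(n) = 1/(2n) + ∑_{k=0}^∞ (1/(k+1) − 1/(k+n)). Equivalently, u(ξ) is asymptotic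 to (1/(2n))·(ξ − 2n·σ(n)); hence the displacement length of the tanh mask vanishes precisely when σ(n) = 0. -/
open Real Filter Set

/-- `σ(n) = 1/(2n) + ψ(n) + γ`, with the digamma-plus-Euler-constant part represented
by the series `∑_{k≥0} (1/(k+1) - 1/(k+n))`. -/
noncomputable def sigmaShift (n : ℝ) : ℝ :=
  1 / (2 * n) + ∑' k : ℕ, (1 / ((k : ℝ) + 1) - 1 / ((k : ℝ) + n))

open MeasureTheory

lemma aux_summable {n : ℝ} (hn : 0 < n) :
    Summable (fun k : ℕ => 1 / ((k : ℝ) + n) - 1 / ((k : ℝ) + 1)) := by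
  have h1 : Summable (fun k : ℕ => 1 / ((k : ℝ) + 1) ^ 2) := by
    have := (summable_nat_add_iff 1).2 (Real.summable_one_div_nat_pow.2 (one_lt_two))
    simpa using this
  refine Summable.of_norm_bounded (h1.mul_left (|1 - n| / min n 1)) fun k => ?_
  have hk : (0 : ℝ) ≤ k := k.cast_nonneg
  have hm : 0 < min n 1 := lt_min hn one_pos
  have hle : min n 1 * (k + 1) ≤ k + n := by
    have := min_le_left n 1
    have := min_le_right n 1
    nlinarith
  rw [div_sub_div _ _ (by positivity) (by positivity), Real.norm_eq_abs, abs_div,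
    abs_of_pos (by positivity : 0 < ((k : ℝ) + n) * (k + 1)), div_mul_div_comm]
  have : 1 * ((k : ℝ) + 1) - (k + n) * 1 = 1 - n := by ring
  rw [this, mul_one]
  apply div_le_div_of_nonneg_left (abs_nonneg _) (by positivity)
  nlinarith

lemma aux_beta {a b : ℝ} (ha : 0 < a) (hb : 0 < b) :
    IntegrableOn (fun t : ℝ => t ^ (a - 1) * (1 - t) ^ (b - 1)) (Ioo 0 1) ∧
    ∫ t in Ioo (0 : ℝ) 1, t ^ (a - 1) * (1 - t) ^ (b - 1) = Gamma a * Gamma b / Gamma (a + b) := by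
  have h1 := Complex.betaIntegral_convergent (u := a) (v := b) (by simpa) (by simpa)
  have h2 := ProbabilityTheory.beta_eq_betaIntegralReal a b ha hb
  rw [intervalIntegrable_iff_integrableOn_Ioo_of_le zero_le_one] at h1
  have he : ∀ x ∈ Ioo (0 : ℝ) 1, (x : ℂ) ^ ((a : ℂ) - 1) * (1 - x) ^ ((b : ℂ) - 1)
      = ((x ^ (a - 1) * (1 - x) ^ (b - 1) : ℝ) : ℂ) := by
    intro x hx
    push_cast [Complex.ofReal_cpow hx.1.le, Complex.ofReal_cpow (sub_nonneg.2 hx.2.le)]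
    rfl
  rw [integrableOn_congr_fun he measurableSet_Ioo] at h1
  refine ⟨by simpa [IntegrableOn] using h1.re, ?_⟩
  rw [ProbabilityTheory.beta, Complex.betaIntegral, intervalIntegral.integral_of_le zero_le_one,
    integral_Ioc_eq_integral_Ioo, setIntegral_congr_fun measurableSet_Ioo he] at h2
  rw [h2]
  exact (congrArg Complex.re (integral_complex_ofReal (μ := volume.restrict (Ioo (0 : ℝ) 1))
    (f := fun t : ℝ => t ^ (a - 1) * (1 - t) ^ (b - 1)))).symm

lemma aux_binom {m : ℝ} (hm : 0 < m) {t : ℝ} (h0 : 0 ≤ t) (h1 : t < 1) :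
    HasSum (fun k : ℕ => Gamma (k + m) / (Gamma m * Nat.factorial k) * t ^ k)
      (1 / (1 - t) ^ m) := by
  have h := (Real.one_div_one_sub_rpow_hasFPowerSeriesOnBall_zero m).hasSum (y := t) (by
    simp [enorm_eq_nnnorm]; rw [← NNReal.coe_lt_coe]; simpa [abs_of_nonneg h0] using h1)
  have hG : ∀ k : ℕ, Gamma (k + m) = Gamma m * (ascPochhammer ℕ k).smeval m := by
    intro k
    induction k with
    | zero => simp
    | succ k ih =>
      push_cast
      rw [show (k : ℝ) + 1 + m = (k + m) + 1 by ring, Gamma_add_one (by positivity), ih,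
        ascPochhammer_succ_right, Polynomial.smeval_mul]
      simp [Polynomial.smeval_add, Polynomial.smeval_natCast]
      ring
  have hGm : Gamma m ≠ 0 := (Gamma_pos_of_pos hm).ne'
  have hf : (fun k : ℕ => Gamma (k + m) / (Gamma m * Nat.factorial k) * t ^ k) =
      fun k : ℕ => (FormalMultilinearSeries.ofScalars ℝ
        (fun n : ℕ => Ring.choose (m + n - 1) n) k) fun _ => t := by
    funext k
    rw [hG, ← Ring.factorial_nsmul_multichoose_eq_ascPochhammer]
    have hf : (Nat.factorial k : ℝ) ≠ 0 := by positivity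
    have h3 : m + k - 1 - k + 1 = m := by ring
    simp [Ring.choose, h3]
    field_simp
  rw [hf]
  simpa only [zero_add] using h

lemma aux_main {n : ℝ} (hn : 0 < n) :
    HasSum (fun k : ℕ => Gamma (k + n) * Gamma (k + n + 1) /
      (Gamma (k + 2 * n + 1) * (Nat.factorial k)) - 1 / ((k : ℝ) + n + 1))
      (∑' k : ℕ, (1 / ((k : ℝ) + n) - 1 / ((k : ℝ) + 1))) := by
  set μ := volume.restrict (Ioo (0 : ℝ) 1) with hμ
  have hmem : ∀ᵐ t ∂μ, t ∈ Ioo (0 : ℝ) 1 := ae_restrict_mem measurableSet_Ioo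
  -- the sign of `t^(n-1) - 1`
  obtain ⟨s, hs1, hs⟩ : ∃ s : ℝ, |s| = 1 ∧
      ∀ t ∈ Ioo (0 : ℝ) 1, |t ^ (n - 1) - 1| = s * (t ^ (n - 1) - 1) := by
    rcases le_total n 1 with h | h
    · refine ⟨1, by simp, fun t ht => ?_⟩
      rw [one_mul, abs_of_nonneg]
      have := Real.one_le_rpow_of_pos_of_le_one_of_nonpos ht.1 ht.2.le (by linarith : n - 1 ≤ 0)
      linarith
    · refine ⟨-1, by simp, fun t ht => ?_⟩
      rw [abs_of_nonpos, neg_one_mul]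
      have := Real.rpow_le_one ht.1.le ht.2.le (by linarith : 0 ≤ n - 1)
      linarith
  set g : ℝ → ℝ := fun t => (t ^ (n - 1) - 1) / (1 - t) with hg
  set F : ℕ → ℝ → ℝ := fun k t => (t ^ (n - 1) - 1) * t ^ k with hF
  have hFsum : ∀ t ∈ Ioo (0 : ℝ) 1, HasSum (fun k => F k t) (g t) := by
    intro t ht
    simpa [hF, hg, div_eq_mul_inv] using
      (hasSum_geometric_of_lt_one ht.1.le ht.2).mul_left (t ^ (n - 1) - 1)
  have hpow : ∀ t ∈ Ioo (0 : ℝ) 1, ∀ k : ℕ,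
      t ^ (((k : ℝ) + n) - 1) = t ^ (n - 1) * t ^ k ∧ t ^ (((k : ℝ) + 1) - 1) = t ^ k := by
    intro t ht k
    refine ⟨?_, by simp⟩
    rw [← Real.rpow_natCast t k, ← Real.rpow_add ht.1]
    ring_nf
  have hFe : ∀ k : ℕ, ∀ t ∈ Ioo (0 : ℝ) 1, t ^ (((k : ℝ) + n) - 1) * (1 - t) ^ ((1 : ℝ) - 1)
      - t ^ (((k : ℝ) + 1) - 1) * (1 - t) ^ ((1 : ℝ) - 1) = F k t := by
    intro k t ht
    rw [(hpow t ht k).1, (hpow t ht k).2]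
    simp [hF]; ring
  have hFint : ∀ k, Integrable (F k) μ := by
    intro k
    have := (aux_beta (a := k + n) (b := 1) (by positivity) one_pos).1.sub
      (aux_beta (a := k + 1) (b := 1) (by positivity) one_pos).1
    exact (integrableOn_congr_fun (hFe k) measurableSet_Ioo).1 this
  have hFval : ∀ k : ℕ, ∫ t, F k t ∂μ = 1 / ((k : ℝ) + n) - 1 / ((k : ℝ) + 1) := by
    intro k
    have h1 := aux_beta (a := k + n) (b := 1) (by positivity) one_pos
    have h2 := aux_beta (a := k + 1) (b := 1) (by positivity) one_pos
    rw [hμ, ← setIntegral_congr_fun measurableSet_Ioo (hFe k), integral_sub h1.1 h2.1,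
      h1.2, h2.2, Gamma_add_one (s := k + n) (by positivity),
      Gamma_add_one (s := (k : ℝ) + 1) (by positivity)]
    have h3 := Gamma_pos_of_pos (s := k + n) (by positivity)
    have h4 := Gamma_pos_of_pos (s := (k : ℝ) + 1) (by positivity)
    have h5 : (0 : ℝ) < k + n := by positivity
    simp only [Gamma_one]
    field_simp
  have hFn : ∀ k, ∫ t, ‖F k t‖ ∂μ = s * (1 / ((k : ℝ) + n) - 1 / ((k : ℝ) + 1)) := by
    intro k
    rw [← hFval, ← integral_const_mul]
    apply integral_congr_ae
    filter_upwards [hmem] with t ht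
    rw [hF]
    simp only [norm_mul, norm_pow, Real.norm_eq_abs, hs t ht, abs_of_pos ht.1]
    ring
  have hFs : Summable fun k => ∫ t, ‖F k t‖ ∂μ := by
    simp_rw [hFn]
    exact (aux_summable hn).mul_left s
  have hgF : ∀ᵐ t ∂μ, ∑' k, F k t = g t := by
    filter_upwards [hmem] with t ht using (hFsum t ht).tsum_eq
  have hgval : ∫ t, g t ∂μ = ∑' k : ℕ, (1 / ((k : ℝ) + n) - 1 / ((k : ℝ) + 1)) := by
    rw [← integral_congr_ae hgF, ← (hasSum_integral_of_summable_integral_norm hFint hFs).tsum_eq]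
    simp_rw [hFval]
  have hgint : Integrable g μ := by
    refine ⟨?_, ?_⟩
    · exact (by fun_prop : Measurable g).aestronglyMeasurable
    · rw [hasFiniteIntegral_iff_enorm]
      calc ∫⁻ t, ‖g t‖ₑ ∂μ ≤ ∫⁻ t, ∑' k, ‖F k t‖ₑ ∂μ := by
            apply lintegral_mono_ae
            filter_upwards [hmem] with t ht
            rw [← (hFsum t ht).tsum_eq]
            exact enorm_tsum_le_tsum_enorm
        _ = ∑' k, ∫⁻ t, ‖F k t‖ₑ ∂μ := lintegral_tsum fun k => (hFint k).1.enorm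
        _ = ∑' k, ENNReal.ofReal (∫ t, ‖F k t‖ ∂μ) := by
            congr 1; ext k; rw [ofReal_integral_norm_eq_lintegral_enorm (hFint k)]
        _ < ⊤ := hFs.tsum_ofReal_lt_top
  -- the second expansion
  set b : ℕ → ℝ := fun k => Gamma (k + (n + 1)) / (Gamma (n + 1) * Nat.factorial k) with hb
  have hbpos : ∀ k, 0 < b k := fun k => by
    have h3 := Gamma_pos_of_pos (s := k + (n + 1)) (by positivity)
    have h4 := Gamma_pos_of_pos (s := n + 1) (by positivity)
    simp only [hb]; positivity
  set H : ℕ → ℝ → ℝ := fun k t => (t ^ (n - 1) - 1) * (1 - t) ^ n * (b k * t ^ k) with hH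
  have hHsum : ∀ t ∈ Ioo (0 : ℝ) 1, HasSum (fun k => H k t) (g t) := by
    intro t ht
    have h := (aux_binom (m := n + 1) (by positivity) ht.1.le ht.2).mul_left
      ((t ^ (n - 1) - 1) * (1 - t) ^ n)
    have h1 : 0 < 1 - t := by linarith [ht.2]
    have h2 : (t ^ (n - 1) - 1) * (1 - t) ^ n * (1 / (1 - t) ^ (n + 1)) = g t := by
      rw [Real.rpow_add_one h1.ne', hg]
      have := Real.rpow_pos_of_pos h1 n
      field_simp
    rwa [h2] at h
  have hHn : ∀ t ∈ Ioo (0 : ℝ) 1, ∀ k, ‖H k t‖ = s * H k t := by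
    intro t ht k
    have h1 : 0 < 1 - t := by linarith [ht.2]
    have := Real.rpow_pos_of_pos h1 n
    have h2 : 0 < b k * t ^ k := mul_pos (hbpos k) (pow_pos ht.1 k)
    simp only [hH]
    rw [Real.norm_eq_abs, abs_mul, abs_mul, hs t ht, abs_of_pos this, abs_of_pos h2]
    ring
  have hHe : ∀ k : ℕ, ∀ t ∈ Ioo (0 : ℝ) 1,
      b k * (t ^ (((k : ℝ) + n) - 1) * (1 - t) ^ ((n + 1 : ℝ) - 1)
      - t ^ (((k : ℝ) + 1) - 1) * (1 - t) ^ ((n + 1 : ℝ) - 1)) = H k t := by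
    intro k t ht
    rw [(hpow t ht k).1, (hpow t ht k).2]
    simp [hH]; ring
  have hHval : ∀ k : ℕ, ∫ t, H k t ∂μ = Gamma (k + n) * Gamma (k + n + 1) /
      (Gamma (k + 2 * n + 1) * (Nat.factorial k)) - 1 / ((k : ℝ) + n + 1) := by
    intro k
    have h1 := aux_beta (a := k + n) (b := n + 1) (by positivity) (by positivity)
    have h2 := aux_beta (a := k + 1) (b := n + 1) (by positivity) (by positivity)
    rw [hμ, ← setIntegral_congr_fun measurableSet_Ioo (hHe k), integral_const_mul,
      integral_sub h1.1 h2.1, h1.2, h2.2, show (k : ℝ) + 1 + (n + 1) = (k + n + 1) + 1 by ring,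
      Gamma_add_one (s := k + n + 1) (by positivity), Real.Gamma_nat_eq_factorial]
    simp only [hb]
    rw [show (k : ℝ) + n + (n + 1) = k + 2 * n + 1 by ring,
      show (k : ℝ) + (n + 1) = k + n + 1 by ring]
    have h3 := Gamma_pos_of_pos (s := k + n + 1) (by positivity)
    have h4 := Gamma_pos_of_pos (s := n + 1) (by positivity)
    have h5 := Gamma_pos_of_pos (s := k + 2 * n + 1) (by positivity)
    have h6 : (0 : ℝ) < k + n + 1 := by positivity
    have hf : (0 : ℝ) < Nat.factorial k := by positivity
    field_simp
  rw [← hgval]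
  simp_rw [← hHval]
  refine hasSum_integral_of_dominated_convergence (fun k t => ‖H k t‖) ?_ ?_ ?_ ?_ ?_
  · intro k
    exact (by simp only [hH]; fun_prop : Measurable (H k)).aestronglyMeasurable
  · intro k; exact ae_of_all _ fun t => le_rfl
  · filter_upwards [hmem] with t ht
    simp_rw [hHn t ht]
    exact (hHsum t ht).summable.mul_left s
  · refine (hgint.const_mul s).congr ?_
    filter_upwards [hmem] with t ht
    simp_rw [hHn t ht]
    exact ((hHsum t ht).mul_left s).tsum_eq.symm
  · filter_upwards [hmem] with t ht using hHsum t ht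

lemma aux_total {n : ℝ} (hn : 0 < n) :
    HasSum (fun k : ℕ => Gamma (k + n) * Gamma (k + n + 1) /
      (Gamma (k + 2 * n + 1) * (Nat.factorial k)) - 1 / ((k : ℝ) + 1))
      (2 * -(sigmaShift n)) := by
  set T := ∑' k : ℕ, (1 / ((k : ℝ) + n) - 1 / ((k : ℝ) + 1)) with hT
  have hTs : HasSum (fun k : ℕ => 1 / ((k : ℝ) + n) - 1 / ((k : ℝ) + 1)) T :=
    (aux_summable hn).hasSum
  have htel : HasSum (fun k : ℕ => 1 / ((k : ℝ) + n + 1) - 1 / ((k : ℝ) + n)) (-(1 / n)) := by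
    have hsm : Summable (fun k : ℕ => 1 / ((k : ℝ) + n + 1) - 1 / ((k : ℝ) + n)) := by
      refine ((aux_summable (n := n + 1) (by positivity)).sub (aux_summable hn)).congr fun k => ?_
      rw [← add_assoc]; ring
    rw [hsm.hasSum_iff_tendsto_nat]
    have h1 : ∀ N : ℕ, ∑ k ∈ Finset.range N, (1 / ((k : ℝ) + n + 1) - 1 / ((k : ℝ) + n))
        = 1 / ((N : ℝ) + n) - 1 / n := by
      intro N
      have := Finset.sum_range_sub (fun k : ℕ => 1 / ((k : ℝ) + n)) N
      simp only [Nat.cast_zero, zero_add] at this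
      rw [← this]
      refine Finset.sum_congr rfl fun k _ => ?_
      push_cast
      rw [add_right_comm]
    simp_rw [h1]
    have h2 : Tendsto (fun N : ℕ => 1 / ((N : ℝ) + n)) atTop (nhds 0) := by
      simp_rw [one_div]
      exact tendsto_inv_atTop_zero.comp
        (tendsto_atTop_add_const_right _ _ tendsto_natCast_atTop_atTop)
    simpa using h2.sub_const (1 / n)
  have h := ((aux_main hn).add htel).add hTs
  have hsig : 2 * -(sigmaShift n) = T + -(1 / n) + T := by
    have : ∑' k : ℕ, (1 / ((k : ℝ) + 1) - 1 / ((k : ℝ) + n)) = -T := by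
      rw [hT, ← tsum_neg]; congr 1; ext k; ring
    rw [sigmaShift, this]
    field_simp
    ring
  rw [hsig]
  refine h.congr_fun ?_
  intro k
  ring

lemma aux_frob {n : ℝ} (hn : 0 < n) {x : ℝ} (h0 : 0 < x) (h1 : x < 1) :
    frobU n x = 1 / 2 * (x ^ n * (∑' k : ℕ, (Gamma (k + n) * Gamma (k + n + 1) /
      (Gamma (k + 2 * n + 1) * (Nat.factorial k)) - 1 / ((k : ℝ) + 1)) * x ^ k)
      + x ^ (n - 1) * (-log (1 - x))) := by
  have hd := (aux_total hn).summable
  have hs : Summable fun k : ℕ => (Gamma (k + n) * Gamma (k + n + 1) /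
      (Gamma (k + 2 * n + 1) * (Nat.factorial k)) - 1 / ((k : ℝ) + 1)) * x ^ k := by
    refine Summable.of_norm_bounded hd.norm fun k => ?_
    rw [norm_mul]
    apply mul_le_of_le_one_right (norm_nonneg _)
    rw [norm_pow, Real.norm_eq_abs, abs_of_pos h0]
    exact pow_le_one₀ h0.le h1.le
  have hl := Real.hasSum_pow_div_log_of_abs_lt_one (x := x) (by rwa [abs_of_pos h0])
  have h := (hs.hasSum.mul_left (x ^ n)).add (hl.mul_left (x ^ (n - 1)))
  rw [frobU, ← h.tsum_eq]
  congr 2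
  ext k
  have e1 : x ^ ((k : ℝ) + n) = x ^ n * x ^ k := by
    rw [Real.rpow_add h0, Real.rpow_natCast, mul_comm]
  have e2 : x ^ n = x ^ (n - 1) * x := by
    rw [← Real.rpow_add_one h0.ne']; ring_nf
  rw [e1, e2]
  ring

/-- the decaying inner solution `u(ξ) = U(z(ξ))` for the tanh mask satisfies
`u(ξ) - ξ/(2n) → -σ(n)` as `ξ → ∞`; i.e. `u` is asymptotic to `(1/(2n))(ξ - 2n σ(n))`,
so the displacement length of the tanh mask vanishes precisely when `σ(n) = 0`. -/
theorem tanh_mask_asymptotic_offset {n : ℝ} (hn : 0 < n) {δ : ℝ} (hδ : δ = 4 * n)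
    (z : ℝ → ℝ) (hz : z = fun ξ => (1 + Real.tanh (2 * ξ / δ)) / 2)
    (u : ℝ → ℝ) (hu : u = fun ξ => frobU n (z ξ)) :
    Tendsto (fun ξ : ℝ => u ξ - ξ / (2 * n)) atTop (nhds (-(sigmaShift n))) := by
  have hn' : n ≠ 0 := hn.ne'
  set P : ℝ → ℝ := fun x => ∑' k : ℕ, (Gamma (k + n) * Gamma (k + n + 1) /
      (Gamma (k + 2 * n + 1) * (Nat.factorial k)) - 1 / ((k : ℝ) + 1)) * x ^ k with hP
  have hzpos : ∀ ξ, 0 < z ξ ∧ z ξ < 1 ∧ 1 - z ξ = exp (-(ξ / n)) * z ξ := by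
    intro ξ
    have e : 2 * ξ / δ = ξ / (2 * n) := by rw [hδ]; field_simp; ring
    have e3 : exp (-(ξ / n)) = exp (-(ξ / (2 * n))) * exp (-(ξ / (2 * n))) := by
      rw [← Real.exp_add]; congr 1; field_simp; ring
    have e4 : exp (-(ξ / (2 * n))) * exp (ξ / (2 * n)) = 1 := by
      rw [← Real.exp_add]; simp
    have hz1 : z ξ = exp (ξ / (2 * n)) / (exp (ξ / (2 * n)) + exp (-(ξ / (2 * n)))) := by
      rw [hz]
      simp only [e, Real.tanh_eq_sinh_div_cosh, Real.sinh_eq, Real.cosh_eq]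
      have := Real.exp_pos (ξ / (2 * n))
      have := Real.exp_pos (-(ξ / (2 * n)))
      field_simp
      ring
    have p1 := Real.exp_pos (ξ / (2 * n))
    have p2 := Real.exp_pos (-(ξ / (2 * n)))
    rw [hz1, e3]
    refine ⟨by positivity, by rw [div_lt_one (by positivity)]; linarith, ?_⟩
    rw [mul_div_assoc', mul_assoc, e4]
    field_simp
    ring
  have hzt : Tendsto z atTop (nhdsWithin 1 (Iio 1)) := by
    refine tendsto_nhdsWithin_iff.2 ⟨?_, Eventually.of_forall fun ξ => (hzpos ξ).2.1⟩
    have h1 : Tendsto (fun ξ : ℝ => exp (-(ξ / n))) atTop (nhds 0) :=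
      Real.tendsto_exp_neg_atTop_nhds_zero.comp (tendsto_id.atTop_div_const hn)
    have h2 : Tendsto (fun ξ => 1 - z ξ) atTop (nhds 0) := by
      refine squeeze_zero (fun ξ => by linarith [(hzpos ξ).2.1]) (fun ξ => ?_) h1
      rw [(hzpos ξ).2.2]
      exact mul_le_of_le_one_right (Real.exp_pos _).le (hzpos ξ).2.1.le
    simpa using h2.const_sub 1
  have hPt : Tendsto P (nhdsWithin 1 (Iio 1)) (nhds (2 * -(sigmaShift n))) :=
    Real.tendsto_tsum_powerSeries_nhdsWithin_lt (aux_total hn).tendsto_sum_nat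
  have hid : Tendsto (fun x : ℝ => x) (nhdsWithin 1 (Iio 1)) (nhds 1) :=
    tendsto_id.mono_left nhdsWithin_le_nhds
  have hpt : Tendsto (fun x : ℝ => x ^ n) (nhdsWithin 1 (Iio 1)) (nhds 1) := by
    simpa using hid.rpow_const (p := n) (Or.inl one_ne_zero)
  have hlt : Tendsto (fun x : ℝ => log x) (nhdsWithin 1 (Iio 1)) (nhds 0) := by
    simpa using hid.log one_ne_zero
  have hsl : Tendsto (fun x : ℝ => slope (fun y : ℝ => y ^ (n - 1)) 1 x)
      (nhdsWithin 1 (Iio 1)) (nhds (n - 1)) := by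
    have h := (Real.hasDerivAt_rpow_const (x := 1) (p := n - 1) (Or.inl one_ne_zero))
    rw [hasDerivAt_iff_tendsto_slope] at h
    simp only [Real.one_rpow, mul_one] at h
    exact h.mono_left (nhdsWithin_mono _ fun x hx => (ne_of_lt hx : x ≠ 1))
  have hxl : Tendsto (fun x : ℝ => log (1 - x) * (1 - x)) (nhdsWithin 1 (Iio 1)) (nhds 0) := by
    have h := (Real.continuous_mul_log.tendsto 0)
    simp only [zero_mul] at h
    have h2 : Tendsto (fun x : ℝ => 1 - x) (nhdsWithin 1 (Iio 1)) (nhds 0) := by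
      simpa using hid.const_sub 1
    refine (h.comp h2).congr fun x => ?_
    simp [mul_comm]
  have hall := (((hpt.mul hPt).add (hsl.mul hxl)).sub hlt).const_mul (1 / 2)
  have hlim : 1 / 2 * (1 * (2 * -(sigmaShift n)) + (n - 1) * 0 - 0) = -(sigmaShift n) := by ring
  rw [hlim] at hall
  refine (hall.comp hzt).congr fun ξ => ?_
  obtain ⟨p0, p1, p2⟩ := hzpos ξ
  have hlog : log (1 - z ξ) = -(ξ / n) + log (z ξ) := by
    rw [p2, Real.log_mul (Real.exp_pos _).ne' p0.ne', Real.log_exp]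
  have hzz : z ξ - 1 ≠ 0 := by linarith
  have hslo : slope (fun y : ℝ => y ^ (n - 1)) 1 (z ξ) * (log (1 - z ξ) * (1 - z ξ))
      = (z ξ ^ (n - 1) - 1) * (-log (1 - z ξ)) := by
    rw [slope_def_field, Real.one_rpow]
    field_simp
    ring
  have hu' : u ξ = frobU n (z ξ) := by rw [hu]
  simp only [Function.comp_apply]
  rw [hslo, hu', aux_frob hn p0 p1]
  have hx : ξ / (2 * n) = 1 / 2 * (ξ / n) := by field_simp
  rw [hx, show ξ / n = log (z ξ) - log (1 - z ξ) by rw [hlog]; ring]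
  simp only [hP]
  ring
end

section
/- Define σ : (0, ∞) → ℝ by σ(n) = 1/(2n) + ∑_{k=0}^∞ (1/(k+1) − 1/(k+n)). Then: (i) σ is strictly increasing on (0, ∞); (ii) σ(n) → −∞ as n → 0⁺; (iii) σ(1) = 1/2 > 0 and σ(1/2) = 1 − 2·log 2 < 0; and consequently (iv) σ has a unique zero n*, and n* lies in the open interval (1/2, 1). -/
open Real Filter Set

/-- The tail term. -/
noncomputable def tailTerm (k : ℕ) (n : ℝ) : ℝ := 1 / ((k : ℝ) + 2) - 1 / ((k : ℝ) + 1 + n)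

lemma tailTerm_bound (k : ℕ) {n : ℝ} (hn : 0 < n) :
    ‖tailTerm k n‖ ≤ |n - 1| * (1 / ((k : ℝ) + 1) ^ 2) := by
  have hk : (0 : ℝ) ≤ k := Nat.cast_nonneg k
  have e : tailTerm k n = (n - 1) * (1 / (((k : ℝ) + 2) * ((k : ℝ) + 1 + n))) := by
    unfold tailTerm
    field_simp
    ring
  rw [e, Real.norm_eq_abs, abs_mul, abs_of_pos (a := 1 / (((k : ℝ) + 2) * ((k : ℝ) + 1 + n)))
    (by positivity)]
  apply mul_le_mul_of_nonneg_left _ (abs_nonneg _)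
  apply one_div_le_one_div_of_le (by positivity)
  nlinarith

lemma summable_sq : Summable (fun k : ℕ => 1 / ((k : ℝ) + 1) ^ 2) := by
  have h := (summable_nat_add_iff 1).2 (Real.summable_one_div_nat_pow.2 (by norm_num : 1 < 2))
  simpa using h

lemma summable_tail {n : ℝ} (hn : 0 < n) : Summable (fun k => tailTerm k n) :=
  Summable.of_norm_bounded (summable_sq.mul_left |n - 1|) (fun k => tailTerm_bound k hn)

lemma summable_full {n : ℝ} (hn : 0 < n) :
    Summable (fun k : ℕ => 1 / ((k : ℝ) + 1) - 1 / ((k : ℝ) + n)) := by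
  rw [← summable_nat_add_iff 1]
  refine (summable_tail hn).congr (fun k => ?_)
  unfold tailTerm
  push_cast
  ring_nf

lemma sigma_eq {n : ℝ} (hn : 0 < n) :
    sigmaShift n = 1 - 1 / (2 * n) + ∑' k : ℕ, tailTerm k n := by
  unfold sigmaShift
  rw [(summable_full hn).tsum_eq_zero_add]
  have : ∀ k : ℕ, 1 / (((k + 1 : ℕ) : ℝ) + 1) - 1 / (((k + 1 : ℕ) : ℝ) + n) = tailTerm k n := by
    intro k
    unfold tailTerm
    push_cast
    ring_nf
  simp_rw [this]
  push_cast
  field_simp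
  ring

lemma tail_mono (k : ℕ) {a b : ℝ} (ha : 0 < a) (hab : a ≤ b) : tailTerm k a ≤ tailTerm k b := by
  unfold tailTerm
  gcongr

lemma sigma_strictMono : StrictMonoOn sigmaShift (Ioi (0 : ℝ)) := by
  intro a ha b hb hab
  have ha' : 0 < a := ha
  have hb' : 0 < b := hb
  rw [sigma_eq ha', sigma_eq hb']
  have h1 := (summable_tail ha').tsum_le_tsum (fun k => tail_mono k ha' hab.le) (summable_tail hb')
  have h2 : 1 / (2 * b) < 1 / (2 * a) := by gcongr
  linarith

lemma sigma_tendsto : Tendsto sigmaShift (nhdsWithin 0 (Ioi 0)) atBot := by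
  have h : Tendsto (fun n : ℝ => 1 - (1 / 2) * n⁻¹) (nhdsWithin 0 (Ioi 0)) atBot := by
    have := (tendsto_inv_nhdsGT_zero (𝕜 := ℝ)).const_mul_atTop (by norm_num : (0 : ℝ) < 1 / 2)
    simpa [sub_eq_add_neg] using
      tendsto_atBot_add_const_left _ (1 : ℝ) (tendsto_neg_atTop_atBot.comp this)
  refine tendsto_atBot_mono' _ ?_ h
  filter_upwards [Ioo_mem_nhdsGT (zero_lt_one (α := ℝ))] with n hn
  rw [sigma_eq hn.1]
  have h0 : ∑' k : ℕ, tailTerm k n ≤ 0 := by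
    refine tsum_nonpos (fun k => ?_)
    refine (tail_mono k hn.1 hn.2.le).trans (le_of_eq ?_)
    unfold tailTerm
    ring_nf
  have : 1 / (2 * n) = 1 / 2 * n⁻¹ := by
    have := hn.1
    field_simp
  linarith

lemma sigma_one : sigmaShift 1 = 1 / 2 := by
  simp [sigmaShift]

lemma partial_half (N : ℕ) :
    ∑ k ∈ Finset.range N, (1 / ((k : ℝ) + 1) - 1 / ((k : ℝ) + 1 / 2))
      = 2 * ((harmonic N : ℝ) - harmonic (2 * N)) := by
  induction N with
  | zero => simp
  | succ N ih =>
    rw [Finset.sum_range_succ, ih, show 2 * (N + 1) = 2 * N + 1 + 1 by ring, harmonic_succ,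
      harmonic_succ, harmonic_succ]
    push_cast
    field_simp
    ring

lemma sigma_half : sigmaShift (1 / 2) = 1 - 2 * Real.log 2 := by
  have h1 := Real.tendsto_harmonic_sub_log
  have h2 := h1.comp (tendsto_id.const_mul_atTop' (by norm_num : 0 < 2))
  have h3 := ((h1.sub h2).sub_const (Real.log 2)).const_mul 2
  have h4 := (summable_full (by norm_num : (0 : ℝ) < 1 / 2)).hasSum.tendsto_sum_nat
  have h5 := tendsto_nhds_unique_of_eventuallyEq h4 h3 (by
    filter_upwards [eventually_gt_atTop 0] with N hN
    rw [partial_half]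
    have : (N : ℝ) ≠ 0 := by positivity
    simp only [Function.comp, id]
    push_cast
    rw [Real.log_mul (by norm_num) this]
    ring)
  unfold sigmaShift
  rw [h5]
  ring

lemma sigma_cont : ContinuousOn sigmaShift (Icc (1 / 2 : ℝ) 1) := by
  have h : ContinuousOn (fun n : ℝ => 1 - 1 / (2 * n) + ∑' k : ℕ, tailTerm k n)
      (Icc (1 / 2 : ℝ) 1) := by
    apply ContinuousOn.add
    · intro x hx
      have : 2 * x ≠ 0 := by linarith [hx.1]
      exact ContinuousAt.continuousWithinAt (by fun_prop (disch := assumption))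
    · refine continuousOn_tsum (fun k x hx => ?_) summable_sq (fun k x hx => ?_)
      · have : (k : ℝ) + 1 + x ≠ 0 := by
          have := hx.1
          positivity
        unfold tailTerm
        exact ContinuousAt.continuousWithinAt (by fun_prop (disch := assumption))
      · refine (tailTerm_bound k (by linarith [hx.1])).trans ?_
        have : |x - 1| ≤ 1 := by rw [abs_le]; constructor <;> linarith [hx.1, hx.2]
        exact mul_le_of_le_one_left (by positivity) this
  exact h.congr (fun x hx => sigma_eq (by linarith [hx.1]))

/-- `σ` is strictly increasing on `(0,∞)`, tends to `-∞` as `n → 0⁺`,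
satisfies `σ(1) = 1/2 > 0` and `σ(1/2) = 1 - 2 log 2 < 0`, and therefore has a unique
zero `n*`, which lies in `(1/2, 1)`. This zero determines the optimal smoothing
`δ* = 4 n*` of the tanh mask. -/
theorem sigmaShift_has_unique_zero :
    StrictMonoOn sigmaShift (Ioi (0 : ℝ)) ∧
    Tendsto sigmaShift (nhdsWithin 0 (Ioi 0)) atBot ∧
    (sigmaShift 1 = 1 / 2 ∧ (0 : ℝ) < 1 / 2) ∧
    (sigmaShift (1 / 2) = 1 - 2 * Real.log 2 ∧ 1 - 2 * Real.log 2 < 0) ∧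
    (∃! nstar : ℝ, nstar ∈ Ioi (0 : ℝ) ∧ sigmaShift nstar = 0) ∧
    (∀ nstar : ℝ, nstar ∈ Ioi (0 : ℝ) → sigmaShift nstar = 0 →
      nstar ∈ Ioo (1 / 2 : ℝ) 1) := by
  have hneg : 1 - 2 * Real.log 2 < 0 := by linarith [Real.log_two_gt_d9]
  refine ⟨sigma_strictMono, sigma_tendsto, ⟨sigma_one, by norm_num⟩, ⟨sigma_half, hneg⟩, ?_, ?_⟩
  · obtain ⟨x, hx, hx0⟩ := intermediate_value_Icc (by norm_num) sigma_cont
      (show (0 : ℝ) ∈ Icc (sigmaShift (1 / 2)) (sigmaShift 1) by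
        rw [sigma_one, sigma_half]
        exact ⟨hneg.le, by norm_num⟩)
    have hxp : x ∈ Ioi (0 : ℝ) := lt_of_lt_of_le (by norm_num) hx.1
    exact ⟨x, ⟨hxp, hx0⟩, fun y hy => sigma_strictMono.injOn hy.1 hxp (hy.2.trans hx0.symm)⟩
  · intro x hx hx0
    constructor
    · rw [← sigma_strictMono.lt_iff_lt (show (1 / 2 : ℝ) ∈ Ioi 0 by norm_num) hx, hx0, sigma_half]
      exact hneg
    · rw [← sigma_strictMono.lt_iff_lt hx (show (1 : ℝ) ∈ Ioi 0 by norm_num), hx0, sigma_one]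
      norm_num
end

section
/- Fix ε ∈ (0, 1/2] and let v₀(x) = x − x² be the true Poiseuille profile (so v₀'' = −2, v₀(0) = v₀(1) = 0). Suppose v : (−∞, 1] → ℝ is bounded, continuously differentiable, satisfies v''(x) = −2 for 0 < x < 1, ε²·v''(x) = v(x) − 2ε² for x < 0, and v(1) = 0. Then v is unique and given by v(x) = 2ε² + C·e^{x/ε} for x ≤ 0 and v(x) = −x² + (C/ε)·x + 2ε² + C for 0 ≤ x ≤ 1, where C = ε(1 − 2ε²)/(1 + ε); moreover the penalization error satisfies ε/4 ≤ sup_{x∈[0,1]} |v(x) − v₀(x)| ≤ 2ε. That is, the unshifted discontinuous mask produces an O(ε) displacement-length error in penalized Poiseuille flow. -/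
open Real Filter Set

lemma eq_of_deriv_zero_aux {f : ℝ → ℝ} {a b : ℝ} (hab : a ≤ b)
    (hc : ContinuousOn f (Icc a b)) (hd : ∀ x ∈ Ioo a b, HasDerivAt f 0 x) : f b = f a := by
  rcases hab.eq_or_lt with h | h
  · rw [h]
  · obtain ⟨c, _, hc'⟩ := exists_hasDerivAt_eq_slope f (fun _ => 0) h hc hd
    have h2 : b - a ≠ 0 := by linarith
    rcases div_eq_zero_iff.mp hc'.symm with h3 | h3
    · linarith
    · exact absurd h3 h2

/-- penalized Poiseuille flow with the unshifted discontinuous mask.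
Any bounded `C¹` solution of `v'' = -2` on `(0,1)`, `ε² v'' = v - 2ε²` on `(-∞,0)`,
with `v(1) = 0`, is uniquely given by the explicit formula with
`C = ε(1-2ε²)/(1+ε)`, and the error against the true profile `v₀(x) = x - x²`
satisfies `ε/4 ≤ sup_{[0,1]} |v - v₀| ≤ 2ε`: an `O(ε)` displacement-length error. -/
theorem poiseuille_unshifted_mask_error
    {ε : ℝ} (hε : ε ∈ Ioc (0 : ℝ) (1 / 2))
    {v : ℝ → ℝ}
    (hbdd : ∃ M : ℝ, ∀ x : ℝ, x ≤ 1 → |v x| ≤ M)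
    (hC1 : ContDiffOn ℝ 1 v (Iic 1))
    (hfluid : ∀ x ∈ Ioo (0 : ℝ) 1, HasDerivAt (deriv v) (-2) x)
    (hsolid : ∀ x : ℝ, x < 0 →
      ∃ d : ℝ, HasDerivAt (deriv v) d x ∧ ε ^ 2 * d = v x - 2 * ε ^ 2)
    (hbc : v 1 = 0) :
    (∀ x : ℝ, x ≤ 0 →
      v x = 2 * ε ^ 2 + (ε * (1 - 2 * ε ^ 2) / (1 + ε)) * Real.exp (x / ε)) ∧
    (∀ x ∈ Icc (0 : ℝ) 1,
      v x = -x ^ 2 + ((ε * (1 - 2 * ε ^ 2) / (1 + ε)) / ε) * x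
        + 2 * ε ^ 2 + ε * (1 - 2 * ε ^ 2) / (1 + ε)) ∧
    (∀ x ∈ Icc (0 : ℝ) 1, |v x - (x - x ^ 2)| ≤ 2 * ε) ∧
    (∃ x ∈ Icc (0 : ℝ) 1, ε / 4 ≤ |v x - (x - x ^ 2)|) := by
  obtain ⟨h0, h12⟩ := hε
  obtain ⟨M, hM⟩ := hbdd
  have hne : ε ≠ 0 := h0.ne'
  have hvc : ContinuousOn v (Iic 1) := hC1.continuousOn
  have hvd : ∀ x : ℝ, x < 1 → HasDerivAt v (deriv v x) x := fun x hx =>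
    ((hC1.differentiableOn one_ne_zero).differentiableAt (Iic_mem_nhds hx)).hasDerivAt
  have hpc : ContinuousOn (deriv v) (Iio 1) :=
    (hC1.mono Iio_subset_Iic_self).continuousOn_deriv_of_isOpen isOpen_Iio le_rfl
  have hexp : ∀ (k x : ℝ), HasDerivAt (fun y => Real.exp (k * y)) (Real.exp (k * x) * k) x := by
    intro k x
    have := ((hasDerivAt_id x).const_mul k).exp
    simpa using this
  -- characteristic combinations in the solid
  have hchar : ∀ s : ℝ, s ^ 2 = ε ^ 2 → ∀ x : ℝ, x ≤ 0 →
      (v x - 2 * ε ^ 2 + s * deriv v x) * Real.exp (-s⁻¹ * x) = v 0 - 2 * ε ^ 2 + s * deriv v 0 := by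
    intro s hs x hx
    have hs0 : s ≠ 0 := by
      rintro rfl
      have : 0 < ε ^ 2 := by positivity
      linarith
    have hsub1 : Icc x 0 ⊆ Iic (1 : ℝ) := fun y hy => le_trans hy.2 zero_le_one
    have hsub2 : Icc x 0 ⊆ Iio (1 : ℝ) := fun y hy => lt_of_le_of_lt hy.2 zero_lt_one
    have key := eq_of_deriv_zero_aux
      (f := fun y => (v y - 2 * ε ^ 2 + s * deriv v y) * Real.exp (-s⁻¹ * y)) hx
      (((hvc.mono hsub1).sub continuousOn_const |>.add
        (continuousOn_const.mul (hpc.mono hsub2))).mul (by fun_prop)) (by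
        intro y hy
        obtain ⟨d, hd, he⟩ := hsolid y hy.2
        have h1 := (((hvd y (hy.2.trans zero_lt_one)).sub_const (2 * ε ^ 2)).add
          (hd.const_mul s)).mul (hexp (-s⁻¹) y)
        refine h1.congr_deriv ?_
        rw [← hs] at he
        have hv : v y - 2 * ε ^ 2 = s ^ 2 * d := by rw [he, hs]
        simp only [Pi.add_apply]
        rw [hv]
        field_simp
        ring)
    simpa using key.symm
  have hA := hchar ε rfl
  have hB := hchar (-ε) (by ring)
  have hBz : v 0 - 2 * ε ^ 2 + -ε * deriv v 0 = 0 := by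
    by_contra hBne
    set A := v 0 - 2 * ε ^ 2 + ε * deriv v 0 with hAdef
    set B := v 0 - 2 * ε ^ 2 + -ε * deriv v 0 with hBdef
    have hBpos : 0 < |B| := abs_pos.mpr hBne
    have hM0 : 0 ≤ M := (abs_nonneg _).trans (hM 0 zero_le_one)
    set K := 2 * (M + 2 * ε ^ 2) + |A| with hK
    have hK0 : 0 ≤ K := by positivity
    set t := K / |B| with ht
    have ht0 : 0 ≤ t := by positivity
    have hx : -(ε * t) ≤ 0 := by
      have : 0 ≤ ε * t := by positivity
      linarith
    have a1 := hA _ hx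
    have b1 := hB _ hx
    have e1 : -ε⁻¹ * -(ε * t) = t := by field_simp
    have e2 : -(-ε)⁻¹ * -(ε * t) = -t := by
      rw [inv_neg]; field_simp
    rw [e1] at a1
    rw [e2] at b1
    have hE : Real.exp t * Real.exp (-t) = 1 := by rw [← Real.exp_add]; simp
    set w := v (-(ε * t)) with hw
    set q := deriv v (-(ε * t)) with hq
    have b2 : B * Real.exp t = w - 2 * ε ^ 2 + -ε * q := by
      rw [← b1, mul_assoc, mul_comm (Real.exp (-t)), hE, mul_one]
    have a2 : A * Real.exp (-t) = w - 2 * ε ^ 2 + ε * q := by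
      rw [← a1, mul_assoc, hE, mul_one]
    have b3 : B * Real.exp t = 2 * (w - 2 * ε ^ 2) - A * Real.exp (-t) := by
      rw [a2, b2]; ring
    have hle : |B| * Real.exp t ≤ K := by
      have h1 : |B| * Real.exp t = |B * Real.exp t| := by
        rw [abs_mul, abs_of_pos (Real.exp_pos t)]
      have h2 : |A * Real.exp (-t)| ≤ |A| := by
        rw [abs_mul, abs_of_pos (Real.exp_pos _)]
        exact mul_le_of_le_one_right (abs_nonneg _) (Real.exp_le_one_iff.mpr (by linarith))
      have h3 := abs_le.mp (hM (-(ε * t)) (by linarith))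
      have h4 := abs_le.mp h2
      have h5 : 0 ≤ ε ^ 2 := by positivity
      rw [h1, b3, abs_le]
      constructor <;> linarith [h3.1, h3.2, h4.1, h4.2]
    have h6 : |B| * (t + 1) ≤ |B| * Real.exp t :=
      mul_le_mul_of_nonneg_left (Real.add_one_le_exp t) hBpos.le
    have h7 : |B| * t = K := by rw [ht]; field_simp
    linarith
  -- fluid
  have hp : ∀ x ∈ Ico (0 : ℝ) 1, deriv v x = deriv v 0 - 2 * x := by
    intro x hx
    have key := eq_of_deriv_zero_aux (f := fun y => deriv v y + 2 * y) hx.1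
      ((hpc.mono (fun y hy => lt_of_le_of_lt hy.2 hx.2)).add (by fun_prop)) (by
        intro y hy
        have h1 := (hfluid y ⟨hy.1, hy.2.trans hx.2⟩).add ((hasDerivAt_id y).const_mul 2)
        refine h1.congr_deriv ?_
        norm_num)
    linarith
  have hv : ∀ x ∈ Icc (0 : ℝ) 1, v x = v 0 + deriv v 0 * x - x ^ 2 := by
    intro x hx
    have key := eq_of_deriv_zero_aux (f := fun y => v y - deriv v 0 * y + y ^ 2) hx.1
      (((hvc.mono (fun y hy => le_trans hy.2 hx.2)).sub (by fun_prop)).add (by fun_prop)) (by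
        intro y hy
        have hy1 : y < 1 := lt_of_lt_of_le hy.2 hx.2
        have h1 := ((hvd y hy1).sub ((hasDerivAt_id y).const_mul (deriv v 0))).add
          (hasDerivAt_pow 2 y)
        refine h1.congr_deriv ?_
        rw [hp y ⟨hy.1.le, hy1⟩]
        push_cast
        ring)
    linarith
  have hv1 := hv 1 ⟨zero_le_one, le_rfl⟩
  rw [hbc] at hv1
  have h1e : 1 + ε ≠ 0 := by positivity
  have ha : deriv v 0 = (1 - 2 * ε ^ 2) / (1 + ε) := by
    rw [eq_div_iff h1e]; linarith
  have hv0 : v 0 = 2 * ε ^ 2 + ε * (1 - 2 * ε ^ 2) / (1 + ε) := by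
    rw [mul_div_assoc, ← ha]; linarith
  have hv0' : v 0 = ε * (1 + 2 * ε) / (1 + ε) := by
    rw [hv0]; field_simp; ring
  have herr : ∀ x ∈ Icc (0 : ℝ) 1, v x - (x - x ^ 2) = v 0 * (1 - x) := by
    intro x hx
    have : deriv v 0 = 1 - v 0 := by linarith
    rw [hv x hx, this]; ring
  have hlo : ε ≤ v 0 := by
    rw [hv0', le_div_iff₀ (by positivity)]; nlinarith
  have hhi : v 0 ≤ 2 * ε := by
    rw [hv0', div_le_iff₀ (by positivity)]; nlinarith
  refine ⟨?_, ?_, ?_, ?_⟩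
  · intro x hx
    have a1 := hA x hx
    have b1 := hB x hx
    rw [hBz] at b1
    have b2 := (mul_eq_zero.mp b1).resolve_right (Real.exp_pos _).ne'
    have hE : Real.exp (-ε⁻¹ * x) * Real.exp (x / ε) = 1 := by
      rw [← Real.exp_add, Real.exp_eq_one_iff]; field_simp; ring
    have a2 : v x - 2 * ε ^ 2 + ε * deriv v x
        = (v 0 - 2 * ε ^ 2 + ε * deriv v 0) * Real.exp (x / ε) := by
      rw [← a1, mul_assoc, hE, mul_one]
    have a3 : v 0 - 2 * ε ^ 2 + ε * deriv v 0 = 2 * (ε * (1 - 2 * ε ^ 2) / (1 + ε)) := by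
      rw [hv0, ha]; ring
    rw [a3] at a2
    linarith
  · intro x hx
    have : ε * (1 - 2 * ε ^ 2) / (1 + ε) / ε = deriv v 0 := by
      rw [ha]; field_simp
    rw [this, hv x hx, hv0]; ring
  · intro x hx
    rw [herr x hx, abs_of_nonneg (mul_nonneg (by linarith) (by linarith [hx.2]))]
    nlinarith [hx.1, hx.2]
  · refine ⟨0, ⟨le_rfl, zero_le_one⟩, ?_⟩
    rw [herr 0 ⟨le_rfl, zero_le_one⟩, sub_zero, mul_one, abs_of_nonneg (by linarith)]
    linarith
end

section
/- Let c > 0 and let Γ be a compact transition mask with half-width c. Let V be the twice continuously differentiable solution of V''(ξ) = Γ(ξ)·V(ξ) with V(c) = 1 and V'(c) = 0. Then V(ξ) = 1 for all ξ ≥ c, V(ξ) ≥ 1 and V'(ξ) ≤ 0 for all ξ ≤ c, and the limit a = lim_{ξ→−∞} e^{ξ}·V(ξ) exists and is strictly positive. That is, the 'unphysical' kernel solution of the inner problem, which tends to 1 in the fluid, grows exponentially like a·e^{−ξ} in the solid. -/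
open Real Filter Set

lemma mono_aux {f f' : ℝ → ℝ} {s : Set ℝ} (hs : Convex ℝ s)
    (hf : ∀ x, HasDerivAt f (f' x) x) (h : ∀ x ∈ s, 0 ≤ f' x) : MonotoneOn f s := by
  apply monotoneOn_of_deriv_nonneg hs
  · exact fun x _ => (hf x).continuousAt.continuousWithinAt
  · exact fun x _ => (hf x).differentiableAt.differentiableWithinAt
  · intro x hx
    rw [(hf x).deriv]
    exact h x (interior_subset hx)

lemma const_aux {f f' : ℝ → ℝ} {s : Set ℝ} (hs : Convex ℝ s)
    (hf : ∀ x, HasDerivAt f (f' x) x) (h : ∀ x ∈ s, f' x = 0)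
    {x y : ℝ} (hx : x ∈ s) (hy : y ∈ s) : f x = f y := by
  have m1 := mono_aux hs hf (fun x hx => (h x hx).ge)
  have m2 := mono_aux (f := fun x => - f x) (f' := fun x => - f' x) hs (fun x => (hf x).neg)
    (fun x hx => by simp [h x hx])
  rcases le_total x y with hxy | hxy
  · have a := m1 hx hy hxy
    have b := m2 hx hy hxy
    simp only at b
    linarith
  · have a := m1 hy hx hxy
    have b := m2 hy hx hxy
    simp only at b
    linarith

/-- the 'unphysical' kernel solution `V` of the inner problem `V'' = Γ V`,
normalized by `V(c) = 1`, `V'(c) = 0`, is identically `1` in the fluid `ξ ≥ c`, satisfies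
`V ≥ 1` and `V' ≤ 0` for `ξ ≤ c`, and grows exponentially like `a e^{-ξ}` in the solid:
the limit `a = lim_{ξ→-∞} e^{ξ} V(ξ)` exists and is strictly positive. -/
theorem unphysical_solution_growth {c : ℝ} (hc : 0 < c) {Γ : ℝ → ℝ}
    (hΓ : CompactMask c Γ) {V : ℝ → ℝ} (hV : ContDiff ℝ 2 V)
    (hode : ∀ ξ : ℝ, deriv (deriv V) ξ = Γ ξ * V ξ)
    (hVc : V c = 1) (hV'c : deriv V c = 0) :
    (∀ ξ : ℝ, c ≤ ξ → V ξ = 1) ∧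
    (∀ ξ : ℝ, ξ ≤ c → 1 ≤ V ξ ∧ deriv V ξ ≤ 0) ∧
    (∃ a : ℝ, 0 < a ∧ Tendsto (fun ξ : ℝ => Real.exp ξ * V ξ) atBot (nhds a)) := by
  have hd1 : ∀ x, HasDerivAt V (deriv V x) x := fun x =>
    (hV.differentiable (by norm_num) x).hasDerivAt
  have hV' : ContDiff ℝ 1 (deriv V) := by
    have h2 : ContDiff ℝ (1 + 1) V := by
      simpa [one_add_one_eq_two] using hV
    exact (contDiff_succ_iff_deriv.1 h2).2.2
  have hd2 : ∀ x, HasDerivAt (deriv V) (Γ x * V x) x := fun x => by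
    rw [← hode x]
    exact (hV'.differentiable (by norm_num) x).hasDerivAt
  have key : ∀ ξ : ℝ, ξ ≤ c → 1 ≤ V ξ ∧ deriv V ξ ≤ 0 := by
    have hp : MonotoneOn (fun x => V x * deriv V x) univ :=
      mono_aux (f' := fun x => deriv V x * deriv V x + V x * (Γ x * V x)) convex_univ
        (fun x => (hd1 x).mul (hd2 x)) (fun x _ => by
          have := mul_nonneg (hΓ.nonneg x) (mul_self_nonneg (V x))
          nlinarith [mul_self_nonneg (deriv V x)])
    have hneg : ∀ x, x ≤ c → V x * deriv V x ≤ 0 := fun x hx => by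
      have := hp (mem_univ x) (mem_univ c) hx
      simpa [hV'c] using this
    have hsq : MonotoneOn (fun x => -(V x * V x)) (Iic c) :=
      mono_aux (f' := fun x => -(deriv V x * V x + V x * deriv V x)) (convex_Iic c)
        (fun x => ((hd1 x).mul (hd1 x)).neg) (fun x hx => by
          have := hneg x hx
          nlinarith)
    have hsq1 : ∀ x, x ≤ c → 1 ≤ V x * V x := fun x hx => by
      have := hsq (mem_Iic.2 hx) (mem_Iic.2 le_rfl) hx
      simp only [hVc] at this
      linarith
    intro ξ hξ
    have hpos : 0 < V ξ := by
      by_contra hcon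
      push Not at hcon
      have h0 : (0 : ℝ) ∈ V '' Icc ξ c :=
        intermediate_value_Icc hξ hV.continuous.continuousOn ⟨hcon, by rw [hVc]; norm_num⟩
      obtain ⟨y, hy, hy0⟩ := h0
      have := hsq1 y hy.2
      rw [hy0] at this
      norm_num at this
    refine ⟨by nlinarith [hsq1 ξ hξ], ?_⟩
    by_contra hcon
    push Not at hcon
    linarith [hneg ξ hξ, mul_pos hpos hcon]
  refine ⟨?_, key, ?_⟩
  · have h1 : ∀ x ∈ Ici c, deriv V x = 0 := fun x hx => by
      rw [← hV'c]
      exact const_aux (convex_Ici c) hd2 (fun y hy => by simp [hΓ.eq_zero y hy]) hx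
        (mem_Ici.2 le_rfl)
    intro ξ hξ
    rw [← hVc]
    exact const_aux (convex_Ici c) hd1 h1 hξ (mem_Ici.2 le_rfl)
  · set A : ℝ := rexp (-c) * (V (-c) - deriv V (-c)) with hA
    set B : ℝ := rexp (- -c) * (V (-c) + deriv V (-c)) with hB
    have hApos : 0 < A := by
      have := key (-c) (by linarith)
      exact mul_pos (exp_pos _) (by linarith)
    have eA : ∀ x, x ≤ -c → rexp x * (V x - deriv V x) = A := fun x hx =>
      const_aux (f := fun x => rexp x * (V x - deriv V x)) (convex_Iic (-c))
        (fun x => (Real.hasDerivAt_exp x).mul ((hd1 x).sub (hd2 x)))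
        (fun y hy => by
          rw [hΓ.eq_one y hy]; ring) (mem_Iic.2 hx) (mem_Iic.2 le_rfl)
    have eB : ∀ x, x ≤ -c → rexp (-x) * (V x + deriv V x) = B := fun x hx =>
      const_aux (f := fun x => rexp (-x) * (V x + deriv V x)) (convex_Iic (-c))
        (fun x => ((hasDerivAt_neg x).exp).mul ((hd1 x).add (hd2 x)))
        (fun y hy => by
          rw [hΓ.eq_one y hy]; ring) (mem_Iic.2 hx) (mem_Iic.2 le_rfl)
    refine ⟨A / 2, by linarith, ?_⟩
    have hlim : Tendsto (fun x : ℝ => A / 2 + B / 2 * (rexp x * rexp x)) atBot (nhds (A / 2)) := by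
      have := ((Real.tendsto_exp_atBot.mul Real.tendsto_exp_atBot).const_mul (B / 2)).const_add
        (A / 2)
      simpa using this
    refine hlim.congr' ?_
    filter_upwards [eventually_le_atBot (-c)] with x hx
    have hE : rexp x * rexp (-x) = 1 := by rw [← Real.exp_add]; simp
    rw [← eA x hx, ← eB x hx]
    linear_combination (rexp x * (V x + deriv V x) / 2) * hE
end
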